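/- arXiv:1503.01175 — 6 statements merged into one kernel-verified Lean document; each statement's English description precedes it below -/
import Mathlib

section
/- For all a > 0, x > 0, and real y, the integral over t in (-∞, ∞) of cos(a t) / (x² + (y - t)²) dt equals (π / x) · e^{-a x} · cos(a y). -/
open Real MeasureTheory

open scoped FourierTransform

theorem cexp_neg_mul_abs_eqOn_Ioi (x : ℝ) (b : ℂ) :
    Set.EqOn (fun t : ℝ ↦ Complex.exp (b * t) * Complex.exp (-(x * |t| : ℝ)))
      (fun t : ℝ ↦ Complex.exp ((b - x) * t)) (Set.Ioi 0) := by
  intro t ht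
  simp only [abs_of_pos (Set.mem_Ioi.1 ht), ← Complex.exp_add]
  congr 1
  push_cast
  ring

theorem cexp_neg_mul_abs_eqOn_Iic (x : ℝ) (b : ℂ) :
    Set.EqOn (fun t : ℝ ↦ Complex.exp (b * t) * Complex.exp (-(x * |t| : ℝ)))
      (fun t : ℝ ↦ Complex.exp ((b + x) * t)) (Set.Iic 0) := by
  intro t ht
  simp only [abs_of_nonpos (Set.mem_Iic.1 ht), ← Complex.exp_add]
  congr 1
  push_cast
  ring

theorem integrableOn_Ioi_cexp_neg_mul_abs {x : ℝ} {b : ℂ} (hb : b.re < x) :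
    IntegrableOn (fun t : ℝ ↦ Complex.exp (b * t) * Complex.exp (-(x * |t| : ℝ)))
      (Set.Ioi 0) :=
  (integrableOn_exp_mul_complex_Ioi (by simpa using hb) 0).congr_fun
    (cexp_neg_mul_abs_eqOn_Ioi x b).symm measurableSet_Ioi

theorem integrableOn_Iic_cexp_neg_mul_abs {x : ℝ} {b : ℂ} (hb : -x < b.re) :
    IntegrableOn (fun t : ℝ ↦ Complex.exp (b * t) * Complex.exp (-(x * |t| : ℝ)))
      (Set.Iic 0) :=
  (integrableOn_exp_mul_complex_Iic (by simp; linarith) 0).congr_fun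
    (cexp_neg_mul_abs_eqOn_Iic x b).symm measurableSet_Iic

theorem integrable_cexp_neg_mul_abs {x : ℝ} (hx : 0 < x) :
    Integrable (fun t : ℝ ↦ Complex.exp (-(x * |t| : ℝ))) := by
  have h := (integrableOn_Iic_cexp_neg_mul_abs (x := x) (b := 0) (by simpa)).union
    (integrableOn_Ioi_cexp_neg_mul_abs (by simpa))
  rw [Set.Iic_union_Ioi, integrableOn_univ] at h
  simpa using h

theorem integral_cexp_mul_cexp_neg_mul_abs {x : ℝ} {b : ℂ} (h₁ : -x < b.re) (h₂ : b.re < x) :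
    ∫ t : ℝ, Complex.exp (b * t) * Complex.exp (-(x * |t| : ℝ))
      = 1 / (b + x) - 1 / (b - x) := by
  rw [← intervalIntegral.integral_Iic_add_Ioi (integrableOn_Iic_cexp_neg_mul_abs h₁)
      (integrableOn_Ioi_cexp_neg_mul_abs h₂),
    setIntegral_congr_fun measurableSet_Iic (cexp_neg_mul_abs_eqOn_Iic x b),
    setIntegral_congr_fun measurableSet_Ioi (cexp_neg_mul_abs_eqOn_Ioi x b),
    integral_exp_mul_complex_Iic (by simp; linarith),
    integral_exp_mul_complex_Ioi (by simpa using h₂)]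
  simp [sub_eq_add_neg, neg_div]

/-- The Fourier transform of `t ↦ exp (-2π x |t|)` is the Poisson kernel. -/
theorem fourier_cexp_neg_mul_abs {x : ℝ} (hx : 0 < x) (w : ℝ) :
    𝓕 (fun t : ℝ ↦ Complex.exp (-(2 * π * x * |t| : ℝ))) w
      = ((x / π * (x ^ 2 + w ^ 2)⁻¹ : ℝ) : ℂ) := by
  have hp : 0 < 2 * π * x := by positivity
  have h := integral_cexp_mul_cexp_neg_mul_abs (x := 2 * π * x)
    (b := ((-2 * π * w : ℝ) : ℂ) * Complex.I) (by simpa using hp) (by simpa using hp)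
  rw [fourier_real_eq_integral_exp_smul]
  simp only [smul_eq_mul]
  refine Eq.trans ?_ (h.trans ?_)
  · congr 1
    ext t
    congr 2
    push_cast
    ring
  · have hd : ((x : ℂ) ^ 2 + w ^ 2) ≠ 0 := by
      exact_mod_cast (by positivity : x ^ 2 + w ^ 2 ≠ 0)
    have hπ : (π : ℂ) ≠ 0 := by exact_mod_cast pi_ne_zero
    have h₁ : (-(w * Complex.I) + x : ℂ) ≠ 0 := fun h ↦ by
      simpa [hx.ne'] using congrArg Complex.re h
    have h₂ : (-(w * Complex.I) - x : ℂ) ≠ 0 := fun h ↦ by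
      simpa [hx.ne'] using congrArg Complex.re h
    have e₁ : ((-2 * π * w : ℝ) : ℂ) * Complex.I + (2 * π * x : ℝ)
        = 2 * π * (-(w * Complex.I) + x) := by push_cast; ring
    have e₂ : ((-2 * π * w : ℝ) : ℂ) * Complex.I - (2 * π * x : ℝ)
        = 2 * π * (-(w * Complex.I) - x) := by push_cast; ring
    rw [e₁, e₂]
    push_cast
    field_simp
    linear_combination (-2 * x * w ^ 2 : ℂ) * Complex.I_sq

theorem integrable_inv_sq_add_sq {x : ℝ} (hx : x ≠ 0) :
    Integrable fun t : ℝ ↦ (x ^ 2 + t ^ 2)⁻¹ := by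
  refine ((integrable_inv_one_add_sq.comp_div hx).const_mul (x ^ 2)⁻¹).congr (.of_forall ?_)
  intro t
  simp only [← mul_inv]
  congr 1
  field_simp

theorem integral_cexp_mul_inv_sq_add_sq {x : ℝ} (hx : 0 < x) (a : ℝ) :
    ∫ t : ℝ, Complex.exp (a * t * Complex.I) * ((x ^ 2 + t ^ 2)⁻¹ : ℝ)
      = (π / x * Real.exp (-(|a| * x)) : ℝ) := by
  have hF : 𝓕 (fun t : ℝ ↦ Complex.exp (-(2 * π * x * |t| : ℝ)))
      = fun w : ℝ ↦ ((x / π * (x ^ 2 + w ^ 2)⁻¹ : ℝ) : ℂ) :=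
    funext (fourier_cexp_neg_mul_abs hx)
  have h := congrFun (Continuous.fourierInv_fourier_eq
    (f := fun t : ℝ ↦ Complex.exp (-(2 * π * x * |t| : ℝ))) (by fun_prop)
    (integrable_cexp_neg_mul_abs (by positivity))
    (by rw [hF]; exact ((integrable_inv_sq_add_sq hx.ne').const_mul _).ofReal)) (a / (2 * π))
  rw [hF, fourierInv_eq'] at h
  have hc : (x / π : ℂ) ≠ 0 := by exact_mod_cast (by positivity : x / π ≠ 0)
  apply mul_left_cancel₀ hc
  rw [← integral_const_mul]
  refine Eq.trans ?_ (h.trans ?_)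
  · congr 1
    ext t
    have e : 2 * π * inner ℝ t (a / (2 * π)) = a * t := by
      simp only [RCLike.inner_apply, conj_trivial]
      field_simp
    rw [e]
    simp only [smul_eq_mul]
    push_cast
    ring
  · rw [abs_div, abs_of_pos two_pi_pos]
    have e : 2 * π * x * (|a| / (2 * π)) = |a| * x := by field_simp
    rw [e]
    have hx' : (x : ℂ) ≠ 0 := by exact_mod_cast hx.ne'
    have hπ : (π : ℂ) ≠ 0 := by exact_mod_cast pi_ne_zero
    push_cast
    field_simp

theorem integral_cexp_mul_inv_sq_add_sub_sq {x : ℝ} (hx : 0 < x) (a y : ℝ) :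
    ∫ t : ℝ, Complex.exp (a * t * Complex.I) * ((x ^ 2 + (y - t) ^ 2)⁻¹ : ℝ)
      = Complex.exp (a * y * Complex.I) * (π / x * Real.exp (-(|a| * x)) : ℝ) := by
  rw [← integral_add_right_eq_self _ y, ← integral_cexp_mul_inv_sq_add_sq hx a,
    ← integral_const_mul]
  congr 1
  ext t
  rw [← mul_assoc, ← Complex.exp_add, show y - (t + y) = -t by ring, neg_sq]
  congr 2
  push_cast
  ring

theorem poisson_cos (a x y : ℝ) (ha : 0 < a) (hx : 0 < x) :
    ∫ t : ℝ, Real.cos (a * t) / (x ^ 2 + (y - t) ^ 2)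
      = (Real.pi / x) * Real.exp (-a * x) * Real.cos (a * y) := by
  have hre : ∀ s c : ℝ, (Complex.exp (a * s * Complex.I) * (c : ℂ)).re = Real.cos (a * s) * c := by
    intro s c
    rw [Complex.re_mul_ofReal, ← Complex.ofReal_mul, Complex.exp_ofReal_mul_I_re]
  have hint : Integrable fun t : ℝ ↦
      Complex.exp (a * t * Complex.I) * ((x ^ 2 + (y - t) ^ 2)⁻¹ : ℝ) := by
    refine ((integrable_inv_sq_add_sq hx.ne').comp_sub_left y).ofReal.bdd_mul (c := 1)
      (Continuous.aestronglyMeasurable (by fun_prop)) (.of_forall fun t ↦ ?_)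
    rw [← Complex.ofReal_mul, Complex.norm_exp_ofReal_mul_I]
  have h := congrArg Complex.re (integral_cexp_mul_inv_sq_add_sub_sq hx a y)
  rw [hre, abs_of_pos ha, ← RCLike.re_to_complex, ← integral_re hint] at h
  simp only [RCLike.re_to_complex, hre, ← div_eq_mul_inv] at h
  rw [h, neg_mul]
  ring
end

section
/- For all a > 0, the integral over t in (0, ∞) of (cos(a t) + t·sin(a t)) / (1 + t²) dt equals π · e^{-a}. -/
open Real MeasureTheory Filter intervalIntegral

theorem Continuous.intervalIntegral_swap {F : ℝ → ℝ → ℝ} (hF : Continuous fun p : ℝ × ℝ => F p.1 p.2)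
    (a b c d : ℝ) :
    ∫ x in a..b, ∫ y in c..d, F x y = ∫ y in c..d, ∫ x in a..b, F x y := by
  apply MeasureTheory.intervalIntegral_intervalIntegral_swap
  exact (hF.continuousOn.integrableOn_compact
    (isCompact_uIcc.prod isCompact_uIcc)).mono_set
      (Set.prod_mono Set.uIoc_subset_uIcc Set.uIoc_subset_uIcc)

/-- The Riemann-Lebesgue lemma for the sine transform on a bounded interval. -/
theorem Continuous.tendsto_intervalIntegral_mul_sin {f : ℝ → ℝ} (hf : Continuous f) {a : ℝ}
    (ha : 0 ≤ a) :
    Tendsto (fun R : ℝ => ∫ s in (0 : ℝ)..a, f s * Real.sin (R * s)) atTop (nhds 0) := by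
  let g : ℝ → ℂ := (Set.Ioc 0 a).indicator fun s => (f s : ℂ)
  have hg : Integrable g := by
    rw [integrable_indicator_iff measurableSet_Ioc]
    exact ((Complex.continuous_ofReal.comp hf).intervalIntegrable 0 a).1
  have hscale : Tendsto (fun R : ℝ => -(R / (2 * π))) atTop (cocompact ℝ) :=
    (tendsto_neg_atTop_atBot.comp (tendsto_id.atTop_div_const (by positivity))).mono_right
      atBot_le_cocompact
  have key := (Complex.continuous_im.tendsto 0).comp
    ((Real.tendsto_integral_exp_smul_cocompact g).comp hscale)
  rw [Complex.zero_im] at key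
  refine key.congr fun R => ?_
  have hint : Integrable fun v : ℝ => Real.fourierChar (-(v * -(R / (2 * π)))) • g v := by
    refine (integrable_norm_iff ?_).1 (by simpa using hg.norm)
    refine AEStronglyMeasurable.smul ?_ hg.1
    have hphase : Continuous fun v : ℝ => -(v * -(R / (2 * π))) := by fun_prop
    exact (continuous_subtype_val.comp
      (Real.continuous_fourierChar.comp hphase)).aestronglyMeasurable
  have him := integral_im hint
  simp only [RCLike.im_eq_complex_im] at him
  rw [Function.comp_apply, Function.comp_apply, ← him, integral_of_le ha,
    ← MeasureTheory.integral_indicator measurableSet_Ioc]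
  refine integral_congr_ae (Eventually.of_forall fun v => ?_)
  by_cases hv : v ∈ Set.Ioc 0 a
  · have hphase : 2 * π * -(v * -(R / (2 * π))) = R * v := by
      field_simp
    simp only [g, Set.indicator_of_mem hv, Circle.smul_def, Real.fourierChar_apply, hphase]
    rw [smul_eq_mul, Complex.im_mul_ofReal, Complex.exp_ofReal_mul_I_im, mul_comm]
  · simp [g, Set.indicator_of_notMem hv]

theorem integral_exp_neg_mul_mul_sin (s R : ℝ) :
    ∫ t in (0 : ℝ)..R, Real.exp (-(t * s)) * Real.sin t =
      (1 - Real.exp (-(R * s)) * (Real.cos R + s * Real.sin R)) / (1 + s ^ 2) := by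
  have hderiv : ∀ t ∈ Set.uIcc 0 R, HasDerivAt
      (fun t => -(Real.exp (-(t * s)) * (Real.cos t + s * Real.sin t)) / (1 + s ^ 2))
      (Real.exp (-(t * s)) * Real.sin t) t := by
    intro t _
    have hexp : HasDerivAt (fun t => Real.exp (-(t * s))) (Real.exp (-(t * s)) * -(1 * s)) t :=
      ((hasDerivAt_id t).mul_const s).neg.exp
    refine ((hexp.mul ((Real.hasDerivAt_cos t).add
      ((Real.hasDerivAt_sin t).const_mul s))).neg.div_const (1 + s ^ 2)).congr_deriv ?_
    simp only [Pi.add_apply]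
    field_simp
    ring
  rw [integral_eq_sub_of_hasDerivAt hderiv (Continuous.intervalIntegrable (by fun_prop) _ _)]
  simp
  ring

theorem integral_mul_exp_neg_mul (t S : ℝ) :
    ∫ s in (0 : ℝ)..S, t * Real.exp (-(t * s)) = 1 - Real.exp (-(t * S)) := by
  have hderiv : ∀ s ∈ Set.uIcc 0 S, HasDerivAt (fun s => -Real.exp (-(t * s)))
      (t * Real.exp (-(t * s))) s := by
    intro s _
    refine (((hasDerivAt_id s).const_mul t).neg.exp).neg.congr_deriv ?_
    simp only [Pi.neg_apply, id_eq]
    ring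
  rw [integral_eq_sub_of_hasDerivAt hderiv (Continuous.intervalIntegrable (by fun_prop) _ _)]
  simp
  ring

theorem integral_exp_neg_mul_le {t : ℝ} (ht : 0 < t) (S : ℝ) :
    ∫ s in (0 : ℝ)..S, Real.exp (-(t * s)) ≤ t⁻¹ := by
  have h := integral_mul_exp_neg_mul t S
  rw [intervalIntegral.integral_const_mul] at h
  rw [← one_div, le_div_iff₀' ht, h]
  linarith [Real.exp_pos (-(t * S))]

theorem Real.mul_sinc (t : ℝ) : t * Real.sinc t = Real.sin t := by
  rcases eq_or_ne t 0 with rfl | ht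
  · simp
  · rw [Real.sinc_of_ne_zero ht, mul_div_cancel₀ _ ht]

theorem integral_sinc_sub_integral_exp_neg_mul_sinc (R S : ℝ) :
    (∫ t in (0 : ℝ)..R, Real.sinc t) - ∫ t in (0 : ℝ)..R, Real.exp (-(t * S)) * Real.sinc t =
      Real.arctan S - ∫ s in (0 : ℝ)..S,
        Real.exp (-(R * s)) * ((Real.cos R + s * Real.sin R) / (1 + s ^ 2)) := by
  have hne : ∀ s : ℝ, 1 + s ^ 2 ≠ 0 := fun s => by positivity
  have hc := Real.continuous_sinc
  have hswap := Continuous.intervalIntegral_swap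
    (F := fun t s => Real.exp (-(t * s)) * Real.sin t) (by fun_prop) 0 R 0 S
  have hleft : ∀ t : ℝ, ∫ s in (0 : ℝ)..S, Real.exp (-(t * s)) * Real.sin t =
      Real.sinc t - Real.exp (-(t * S)) * Real.sinc t := by
    intro t
    have h := integral_mul_exp_neg_mul t S
    rw [intervalIntegral.integral_const_mul] at h
    rw [intervalIntegral.integral_mul_const, ← Real.mul_sinc]
    linear_combination Real.sinc t * h
  have hright : ∀ s : ℝ, ∫ t in (0 : ℝ)..R, Real.exp (-(t * s)) * Real.sin t =
      (1 + s ^ 2)⁻¹ - Real.exp (-(R * s)) * ((Real.cos R + s * Real.sin R) / (1 + s ^ 2)) := by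
    intro s
    rw [integral_exp_neg_mul_mul_sin]
    ring
  have hdecay : Continuous fun t : ℝ => Real.exp (-(t * S)) * Real.sinc t := by fun_prop
  have hcont : Continuous fun s : ℝ =>
      Real.exp (-(R * s)) * ((Real.cos R + s * Real.sin R) / (1 + s ^ 2)) := by
    fun_prop (disch := exact hne _)
  simp only [hleft, hright] at hswap
  rw [intervalIntegral.integral_sub (hc.intervalIntegrable _ _)
      (hdecay.intervalIntegrable _ _),
    intervalIntegral.integral_sub intervalIntegrable_inv_one_add_sq
      (hcont.intervalIntegrable _ _),
    integral_inv_one_add_sq] at hswap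
  simpa using hswap

theorem abs_integral_exp_neg_mul_mul_le {t S C : ℝ} (ht : 0 < t) (hS : 0 ≤ S) {f : ℝ → ℝ}
    (hf : ∀ s, 0 ≤ s → |f s| ≤ C) :
    |∫ s in (0 : ℝ)..S, Real.exp (-(t * s)) * f s| ≤ C * t⁻¹ := by
  have hC : 0 ≤ C := (abs_nonneg _).trans (hf 0 le_rfl)
  calc |∫ s in (0 : ℝ)..S, Real.exp (-(t * s)) * f s|
      ≤ ∫ s in (0 : ℝ)..S, C * Real.exp (-(t * s)) := by
        have hbound : Continuous fun s : ℝ => C * Real.exp (-(t * s)) := by fun_prop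
        rw [← Real.norm_eq_abs]
        refine norm_integral_le_of_norm_le hS (Eventually.of_forall fun s hs => ?_)
          (hbound.intervalIntegrable _ _)
        rw [Real.norm_eq_abs, abs_mul, Real.abs_exp, mul_comm]
        exact mul_le_mul_of_nonneg_right (hf s hs.1.le) (Real.exp_pos _).le
    _ ≤ C * t⁻¹ := by
        rw [intervalIntegral.integral_const_mul]
        exact mul_le_mul_of_nonneg_left (integral_exp_neg_mul_le ht S) hC

theorem abs_integral_sinc_sub_arctan_le {R : ℝ} (hR : 0 < R) :
    |(∫ t in (0 : ℝ)..R, Real.sinc t) - Real.arctan R| ≤ 3 * R⁻¹ := by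
  have h := integral_sinc_sub_integral_exp_neg_mul_sinc R R
  have h₁ : |∫ t in (0 : ℝ)..R, Real.exp (-(t * R)) * Real.sinc t| ≤ 1 * R⁻¹ := by
    simp only [mul_comm _ R]
    exact abs_integral_exp_neg_mul_mul_le hR hR.le fun s _ => Real.abs_sinc_le_one s
  have h₂ : |∫ s in (0 : ℝ)..R,
      Real.exp (-(R * s)) * ((Real.cos R + s * Real.sin R) / (1 + s ^ 2))| ≤ 2 * R⁻¹ := by
    refine abs_integral_exp_neg_mul_mul_le hR hR.le fun s hs => ?_
    rw [abs_div, abs_of_pos (by positivity : 0 < 1 + s ^ 2), div_le_iff₀ (by positivity)]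
    have hsin : |s * Real.sin R| ≤ s := by
      rw [abs_mul, abs_of_nonneg hs]
      exact mul_le_of_le_one_right hs (Real.abs_sin_le_one R)
    nlinarith [abs_add_le (Real.cos R) (s * Real.sin R), Real.abs_cos_le_one R,
      sq_nonneg (s - 1)]
  rw [abs_le] at h₁ h₂ ⊢
  constructor <;> linarith

/-- The Dirichlet integral. -/
theorem tendsto_integral_sinc :
    Tendsto (fun R : ℝ => ∫ t in (0 : ℝ)..R, Real.sinc t) atTop (nhds (π / 2)) := by
  have hdiff : Tendsto (fun R : ℝ => (∫ t in (0 : ℝ)..R, Real.sinc t) - Real.arctan R) atTop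
      (nhds 0) := by
    refine squeeze_zero_norm' ?_
      (by simpa using (tendsto_inv_atTop_zero (𝕜 := ℝ)).const_mul 3)
    filter_upwards [eventually_gt_atTop 0] with R hR
    exact abs_integral_sinc_sub_arctan_le hR
  simpa using hdiff.add (tendsto_nhds_of_tendsto_nhdsWithin Real.tendsto_arctan_atTop)

theorem integral_cos_mul_eq_mul_sinc (s R : ℝ) :
    ∫ t in (0 : ℝ)..R, Real.cos (s * t) = R * Real.sinc (R * s) := by
  rcases eq_or_ne s 0 with rfl | hs
  · simp
  · rcases eq_or_ne R 0 with rfl | hR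
    · simp
    · rw [integral_comp_mul_left (fun x => Real.cos x) hs, integral_cos,
        Real.sinc_of_ne_zero (mul_ne_zero hR hs)]
      simp
      field_simp

theorem integral_exp_mul_cos (a t : ℝ) :
    ∫ s in (0 : ℝ)..a, Real.exp s * Real.cos (s * t) =
      Real.exp a * ((Real.cos (a * t) + t * Real.sin (a * t)) / (1 + t ^ 2)) - (1 + t ^ 2)⁻¹ := by
  have hderiv : ∀ s ∈ Set.uIcc 0 a, HasDerivAt
      (fun s => Real.exp s * (Real.cos (s * t) + t * Real.sin (s * t)) / (1 + t ^ 2))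
      (Real.exp s * Real.cos (s * t)) s := by
    intro s _
    have hmul : HasDerivAt (fun s => s * t) (1 * t) s := (hasDerivAt_id s).mul_const t
    refine (((Real.hasDerivAt_exp s).mul (hmul.cos.add
      (hmul.sin.const_mul t))).div_const (1 + t ^ 2)).congr_deriv ?_
    simp only [Pi.add_apply]
    field_simp
    ring
  rw [integral_eq_sub_of_hasDerivAt hderiv (Continuous.intervalIntegrable (by fun_prop) _ _)]
  simp
  ring

theorem continuous_dslope_exp : Continuous (dslope Real.exp 0) := by
  rw [← continuousOn_univ, continuousOn_dslope univ_mem]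
  exact ⟨Real.continuous_exp.continuousOn, Real.differentiableAt_exp⟩

theorem exp_mul_integral_cos_add_mul_sin (a R : ℝ) :
    Real.exp a *
        ∫ t in (0 : ℝ)..R, (Real.cos (a * t) + t * Real.sin (a * t)) / (1 + t ^ 2) =
      Real.arctan R + (∫ t in (0 : ℝ)..R * a, Real.sinc t) +
        ∫ s in (0 : ℝ)..a, dslope Real.exp 0 s * Real.sin (R * s) := by
  have hne : ∀ s : ℝ, 1 + s ^ 2 ≠ 0 := fun s => by positivity
  have hc := Real.continuous_sinc
  have hd := continuous_dslope_exp
  have hswap := Continuous.intervalIntegral_swap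
    (F := fun t s => Real.exp s * Real.cos (s * t)) (by fun_prop) 0 R 0 a
  have hinner : ∀ s : ℝ, Real.exp s * (R * Real.sinc (R * s)) =
      R * Real.sinc (R * s) + dslope Real.exp 0 s * Real.sin (R * s) := by
    intro s
    have h := sub_smul_dslope Real.exp 0 s
    simp only [smul_eq_mul, sub_zero, Real.exp_zero] at h
    rw [← Real.mul_sinc (R * s)]
    linear_combination -(R * Real.sinc (R * s)) * h
  have hcos : Continuous fun t : ℝ =>
      Real.exp a * ((Real.cos (a * t) + t * Real.sin (a * t)) / (1 + t ^ 2)) := by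
    fun_prop (disch := exact hne _)
  have hsinc : Continuous fun s : ℝ => R * Real.sinc (R * s) := by fun_prop
  have hslope : Continuous fun s : ℝ => dslope Real.exp 0 s * Real.sin (R * s) := by fun_prop
  simp only [integral_exp_mul_cos, intervalIntegral.integral_const_mul,
    integral_cos_mul_eq_mul_sinc, hinner] at hswap
  rw [intervalIntegral.integral_sub (hcos.intervalIntegrable _ _)
      intervalIntegrable_inv_one_add_sq,
    intervalIntegral.integral_add (hsinc.intervalIntegrable _ _)
      (hslope.intervalIntegrable _ _),
    intervalIntegral.integral_const_mul, intervalIntegral.integral_const_mul,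
    mul_integral_comp_mul_left, integral_inv_one_add_sq] at hswap
  simp only [mul_zero, Real.arctan_zero, sub_zero] at hswap
  linarith

theorem cos_plus_t_sin_integral (a : ℝ) (ha : 0 < a) :
    Tendsto (fun R : ℝ =>
        ∫ t in (0:ℝ)..R, (Real.cos (a * t) + t * Real.sin (a * t)) / (1 + t ^ 2))
      atTop (nhds (Real.pi * Real.exp (-a))) := by
  have h := ((tendsto_nhds_of_tendsto_nhdsWithin Real.tendsto_arctan_atTop).add
    (tendsto_integral_sinc.comp (tendsto_id.atTop_mul_const ha))).add
    (continuous_dslope_exp.tendsto_intervalIntegral_mul_sin ha.le)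
  rw [add_zero, add_halves] at h
  refine (h.mul_const (Real.exp (-a))).congr fun R => ?_
  simp only [Function.comp_apply, id_eq]
  rw [← exp_mul_integral_cos_add_mul_sin, mul_right_comm, ← Real.exp_add]
  simp
end

section
/- For all x > 0 and 0 < a < b, the integral over t in (0, ∞) of t·cos(b t)·sin(a t) / (x² + t²) dt equals −(π/2) · e^{-b x} · sinh(a x). -/
open Real MeasureTheory Filter intervalIntegral

/-- The one-sided function `u ↦ u⁺ e^{-xu}`. -/
noncomputable def ramp (x u : ℝ) : ℂ := ((max u 0 * Real.exp (-x * u) : ℝ) : ℂ)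

theorem continuous_ramp (x : ℝ) : Continuous (ramp x) := by
  unfold ramp; fun_prop

theorem ramp_eq_indicator (x : ℝ) :
    ramp x = (Set.Ioi 0).indicator fun u : ℝ => ((u * Real.exp (-x * u) : ℝ) : ℂ) := by
  ext u
  by_cases hu : 0 < u
  · simp [ramp, Set.indicator, hu, hu.le]
  · simp [ramp, Set.indicator, hu, le_of_not_gt hu]

theorem integrable_ramp {x : ℝ} (hx : 0 < x) : Integrable (ramp x) := by
  rw [ramp_eq_indicator, integrable_indicator_iff measurableSet_Ioi]
  have h := integrableOn_rpow_mul_exp_neg_mul_rpow (s := 1) (p := 1) (b := x) (by norm_num)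
    one_pos hx
  simp only [Real.rpow_one] at h
  exact Integrable.ofReal h

theorem integrableOn_mul_exp_neg_mul {r : ℂ} (hr : 0 < r.re) :
    IntegrableOn (fun u : ℝ => (u : ℂ) * Complex.exp (-r * u)) (Set.Ioi 0) := by
  have h := integrableOn_rpow_mul_exp_neg_mul_rpow (s := 1) (p := 1) (b := r.re) (by norm_num)
    one_pos hr
  simp only [Real.rpow_one] at h
  refine Integrable.mono h ?_ (.of_forall fun u => ?_)
  · exact Continuous.aestronglyMeasurable (by fun_prop)
  · simp [Complex.norm_exp]

theorem integral_mul_exp_neg_mul_s7 {r : ℂ} (hr : 0 < r.re) :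
    ∫ u : ℝ in Set.Ioi 0, (u : ℂ) * Complex.exp (-r * u) = 1 / r ^ 2 := by
  have hr0 : r ≠ 0 := by rintro rfl; simp at hr
  have hderiv : ∀ u ∈ Set.Ici (0 : ℝ), HasDerivAt
      (fun u : ℝ => -((u : ℂ) / r + 1 / r ^ 2) * Complex.exp (-r * u))
      ((u : ℂ) * Complex.exp (-r * u)) u := by
    intro u _
    have h1 : HasDerivAt (fun u : ℝ => (u : ℂ)) 1 u := Complex.ofRealCLM.hasDerivAt
    convert! (((h1.div_const r).add_const (1 / r ^ 2)).neg.mul (h1.const_mul (-r)).cexp) using 1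
    simp only [Pi.neg_apply]
    field_simp
    ring
  have hlim : Tendsto (fun u : ℝ => -((u : ℂ) / r + 1 / r ^ 2) * Complex.exp (-r * u))
      atTop (nhds 0) := by
    have h1 := tendsto_rpow_mul_exp_neg_mul_atTop_nhds_zero 1 r.re hr
    have h0 := tendsto_rpow_mul_exp_neg_mul_atTop_nhds_zero 0 r.re hr
    simp only [Real.rpow_one, Real.rpow_zero, one_mul] at h1 h0
    have h := (h1.const_mul ‖r‖⁻¹).add (h0.const_mul (‖r‖ ^ 2)⁻¹)
    simp only [mul_zero, add_zero] at h
    refine squeeze_zero_norm' ?_ h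
    filter_upwards [eventually_ge_atTop 0] with u hu
    have hexp : ‖Complex.exp (-r * u)‖ = Real.exp (-r.re * u) := by simp [Complex.norm_exp]
    rw [norm_mul, norm_neg, hexp, ← mul_assoc, ← add_mul]
    refine mul_le_mul_of_nonneg_right ((norm_add_le _ _).trans_eq ?_) (Real.exp_pos _).le
    simp [abs_of_nonneg hu, div_eq_inv_mul]
  rw [integral_Ioi_of_hasDerivAt_of_tendsto' hderiv (integrableOn_mul_exp_neg_mul hr) hlim]
  simp

theorem fourier_ramp {x : ℝ} (hx : 0 < x) (w : ℝ) :
    FourierTransform.fourier (ramp x) w = 1 / ((x : ℂ) + 2 * π * w * Complex.I) ^ 2 := by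
  rw [Real.fourier_eq', ramp_eq_indicator,
    ← integral_mul_exp_neg_mul_s7 (r := (x : ℂ) + 2 * π * w * Complex.I) (by simpa using hx),
    ← MeasureTheory.integral_indicator measurableSet_Ioi]
  congr 1
  ext u
  by_cases hu : u ∈ Set.Ioi (0 : ℝ)
  · simp only [Set.indicator_of_mem hu, smul_eq_mul]
    push_cast
    rw [mul_left_comm, ← Complex.exp_add]
    congr 2
    simp
    ring
  · simp [Set.indicator_of_notMem hu]

theorem norm_one_div_add_mul_I_sq (x t : ℝ) :
    ‖1 / ((x : ℂ) + t * Complex.I) ^ 2‖ = (x ^ 2 + t ^ 2)⁻¹ := by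
  rw [norm_div, norm_one, norm_pow, Complex.sq_norm, Complex.normSq_add_mul_I, one_div]

theorem integrable_one_div_add_mul_I_sq {x : ℝ} (hx : 0 < x) :
    Integrable fun t : ℝ => 1 / ((x : ℂ) + t * Complex.I) ^ 2 := by
  refine (integrable_inv_one_add_sq.const_mul (1 + 1 / x ^ 2)).mono' ?_ ?_
  · refine Measurable.aestronglyMeasurable ?_
    fun_prop
  · filter_upwards with t
    rw [norm_one_div_add_mul_I_sq, ← div_eq_mul_inv, inv_eq_one_div,
      div_le_div_iff₀ (by positivity) (by positivity)]
    have : (1 + 1 / x ^ 2) * (x ^ 2 + t ^ 2) = 1 + t ^ 2 + x ^ 2 + t ^ 2 / x ^ 2 := by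
      field_simp; ring
    rw [this]
    have : 0 ≤ t ^ 2 / x ^ 2 := by positivity
    nlinarith [sq_nonneg x]

theorem integral_exp_mul_I_div_add_mul_I_sq {x : ℝ} (hx : 0 < x) (c : ℝ) :
    ∫ t : ℝ, Complex.exp (c * t * Complex.I) / ((x : ℂ) + t * Complex.I) ^ 2
      = 2 * π * ramp x c := by
  have hF : FourierTransform.fourier (ramp x)
      = fun w : ℝ => 1 / ((x : ℂ) + ((2 * π * w : ℝ) : ℂ) * Complex.I) ^ 2 := by
    ext w
    simp [fourier_ramp hx]
  have hint : Integrable (FourierTransform.fourier (ramp x)) := by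
    rw [hF]
    exact (integrable_one_div_add_mul_I_sq hx).comp_mul_left' (by positivity)
  have h := congrFun ((continuous_ramp x).fourierInv_fourier_eq (integrable_ramp hx) hint) c
  rw [hF, Real.fourierInv_eq'] at h
  have hs := Measure.integral_comp_mul_left
    (fun t : ℝ => Complex.exp (c * t * Complex.I) / ((x : ℂ) + t * Complex.I) ^ 2) (2 * π)
  rw [abs_of_pos (by positivity)] at hs
  have hp : (2 * π : ℂ) ≠ 0 := by simp [Real.pi_ne_zero]
  rw [← h]
  have : ∀ v : ℝ, Complex.exp (((2 * π * inner ℝ v c : ℝ) : ℂ) * Complex.I) •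
      (1 / ((x : ℂ) + ((2 * π * v : ℝ) : ℂ) * Complex.I) ^ 2) =
      Complex.exp (c * ((2 * π * v : ℝ) : ℂ) * Complex.I) /
        ((x : ℂ) + ((2 * π * v : ℝ) : ℂ) * Complex.I) ^ 2 := by
    intro v
    simp only [smul_eq_mul, mul_one_div]
    congr 3
    simp
    ring
  simp only [this]
  rw [hs, Complex.real_smul]
  push_cast
  rw [mul_inv_cancel_left₀ hp]

theorem integrable_exp_mul_I_div_add_mul_I_sq {x : ℝ} (hx : 0 < x) (c : ℝ) :
    Integrable fun t : ℝ => Complex.exp (c * t * Complex.I) / ((x : ℂ) + t * Complex.I) ^ 2 := by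
  have := (integrable_one_div_add_mul_I_sq hx).bdd_mul (c := 1)
    (f := fun t : ℝ => Complex.exp (c * t * Complex.I))
    (Continuous.aestronglyMeasurable (by fun_prop)) (.of_forall fun t => by
      rw [← Complex.ofReal_mul, Complex.norm_exp_ofReal_mul_I])
  simpa only [mul_one_div] using this

theorem re_cos_div_add_mul_I_sq (c x t : ℝ) :
    (Complex.cos (c * t) / ((x : ℂ) + t * Complex.I) ^ 2).re =
      Real.cos (c * t) * (x ^ 2 - t ^ 2) / (x ^ 2 + t ^ 2) ^ 2 := by
  rw [← Complex.ofReal_mul, ← Complex.ofReal_cos, Complex.div_re, map_pow,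
    Complex.normSq_add_mul_I, Complex.ofReal_re, Complex.ofReal_im]
  simp [pow_two]

theorem cos_div_add_mul_I_sq (c x t : ℝ) :
    Complex.cos (c * t) / ((x : ℂ) + t * Complex.I) ^ 2 =
      (Complex.exp (c * t * Complex.I) / ((x : ℂ) + t * Complex.I) ^ 2 +
        Complex.exp ((-c : ℝ) * t * Complex.I) / ((x : ℂ) + t * Complex.I) ^ 2) / 2 := by
  rw [Complex.cos, ← add_div, div_right_comm]
  simp

theorem integrable_cos_div_add_mul_I_sq {x : ℝ} (hx : 0 < x) (c : ℝ) :
    Integrable fun t : ℝ => Complex.cos (c * t) / ((x : ℂ) + t * Complex.I) ^ 2 := by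
  simp_rw [cos_div_add_mul_I_sq]
  exact ((integrable_exp_mul_I_div_add_mul_I_sq hx c).add
    (integrable_exp_mul_I_div_add_mul_I_sq hx (-c))).div_const 2

theorem integral_cos_div_add_mul_I_sq {x c : ℝ} (hx : 0 < x) (hc : 0 < c) :
    ∫ t : ℝ, Complex.cos (c * t) / ((x : ℂ) + t * Complex.I) ^ 2
      = ((π * c * Real.exp (-x * c) : ℝ) : ℂ) := by
  simp_rw [cos_div_add_mul_I_sq]
  rw [MeasureTheory.integral_div, MeasureTheory.integral_add
    (integrable_exp_mul_I_div_add_mul_I_sq hx c) (integrable_exp_mul_I_div_add_mul_I_sq hx (-c)),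
    integral_exp_mul_I_div_add_mul_I_sq hx, integral_exp_mul_I_div_add_mul_I_sq hx]
  simp [ramp, hc.le]
  ring

theorem integrable_cos_mul_sq_sub_sq_div {x : ℝ} (hx : 0 < x) (c : ℝ) :
    Integrable fun t : ℝ => Real.cos (c * t) * (x ^ 2 - t ^ 2) / (x ^ 2 + t ^ 2) ^ 2 := by
  simpa only [RCLike.re_to_complex, re_cos_div_add_mul_I_sq] using
    (integrable_cos_div_add_mul_I_sq hx c).re

theorem integral_Ioi_cos_mul_sq_sub_sq_div {x c : ℝ} (hx : 0 < x) (hc : 0 < c) :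
    ∫ t in Set.Ioi (0 : ℝ), Real.cos (c * t) * (x ^ 2 - t ^ 2) / (x ^ 2 + t ^ 2) ^ 2
      = π / 2 * c * Real.exp (-x * c) := by
  have h := integral_re (integrable_cos_div_add_mul_I_sq hx c)
  rw [integral_cos_div_add_mul_I_sq hx hc] at h
  simp only [RCLike.re_to_complex, re_cos_div_add_mul_I_sq, Complex.ofReal_re] at h
  have h2 := integral_comp_abs
    (f := fun t => Real.cos (c * t) * (x ^ 2 - t ^ 2) / (x ^ 2 + t ^ 2) ^ 2)
  have : ∀ t : ℝ, Real.cos (c * |t|) = Real.cos (c * t) := fun t => by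
    rw [← Real.cos_abs (c * t), abs_mul, abs_of_pos hc]
  simp only [this, sq_abs] at h2
  linarith

theorem integral_mul_sin_div_sq_add_sq {x c : ℝ} (hx : 0 < x) (hc : 0 < c) (R : ℝ) :
    ∫ t in (0 : ℝ)..R, t * Real.sin (c * t) / (x ^ 2 + t ^ 2) =
      c⁻¹ * (∫ t in (0 : ℝ)..R, Real.cos (c * t) * (x ^ 2 - t ^ 2) / (x ^ 2 + t ^ 2) ^ 2)
        - c⁻¹ * (Real.cos (c * R) * (R / (x ^ 2 + R ^ 2))) := by
  have hne : ∀ t : ℝ, x ^ 2 + t ^ 2 ≠ 0 := fun t => by positivity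
  have hderiv : ∀ t ∈ Set.uIcc 0 R, HasDerivAt
      (fun t : ℝ => -(c⁻¹ * (Real.cos (c * t) * (t / (x ^ 2 + t ^ 2)))))
      (t * Real.sin (c * t) / (x ^ 2 + t ^ 2) -
        c⁻¹ * (Real.cos (c * t) * (x ^ 2 - t ^ 2) / (x ^ 2 + t ^ 2) ^ 2)) t := by
    intro t _
    have h1 := ((hasDerivAt_id t).const_mul c).cos
    have h2 := (hasDerivAt_id t).fun_div (((hasDerivAt_id t).fun_pow 2).const_add (x ^ 2)) (hne t)
    convert! ((h1.mul h2).const_mul c⁻¹).neg using 1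
    have := hne t
    simp only [id]
    field_simp
    ring
  have hi1 : IntervalIntegrable (fun t : ℝ => t * Real.sin (c * t) / (x ^ 2 + t ^ 2))
      volume 0 R := by
    refine Continuous.intervalIntegrable ?_ _ _
    fun_prop (disch := exact hne _)
  have hi2 := ((integrable_cos_mul_sq_sub_sq_div hx c).intervalIntegrable
    (a := 0) (b := R)).const_mul c⁻¹
  have h := intervalIntegral.integral_eq_sub_of_hasDerivAt hderiv (hi1.sub hi2)
  rw [intervalIntegral.integral_sub hi1 hi2, intervalIntegral.integral_const_mul] at h
  simp only [zero_div, mul_zero, neg_zero, sub_zero] at h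
  linarith

theorem tendsto_integral_mul_sin_div_sq_add_sq {x c : ℝ} (hx : 0 < x) (hc : 0 < c) :
    Tendsto (fun R : ℝ => ∫ t in (0 : ℝ)..R, t * Real.sin (c * t) / (x ^ 2 + t ^ 2)) atTop
      (nhds (π / 2 * Real.exp (-x * c))) := by
  simp_rw [integral_mul_sin_div_sq_add_sq hx hc]
  have h1 := intervalIntegral_tendsto_integral_Ioi 0
    (integrable_cos_mul_sq_sub_sq_div hx c).integrableOn tendsto_id
  rw [integral_Ioi_cos_mul_sq_sub_sq_div hx hc] at h1
  have h2 : Tendsto (fun R : ℝ => Real.cos (c * R) * (R / (x ^ 2 + R ^ 2))) atTop (nhds 0) := by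
    refine squeeze_zero_norm' ?_ tendsto_inv_atTop_zero
    filter_upwards [eventually_gt_atTop 0] with R hR
    rw [norm_mul, Real.norm_eq_abs, Real.norm_eq_abs, abs_of_pos (by positivity : 0 < R / _)]
    refine (mul_le_of_le_one_left (by positivity) (Real.abs_cos_le_one _)).trans ?_
    rw [inv_eq_one_div, div_le_div_iff₀ (by positivity) hR]
    nlinarith [sq_nonneg x]
  convert! (h1.const_mul c⁻¹).sub (h2.const_mul c⁻¹) using 2
  field_simp
  ring

theorem t_cos_sin_integral (a b x : ℝ) (hx : 0 < x) (ha : 0 < a) (hab : a < b) :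
    Tendsto (fun R : ℝ =>
        ∫ t in (0:ℝ)..R, t * Real.cos (b * t) * Real.sin (a * t) / (x ^ 2 + t ^ 2))
      atTop (nhds (-(Real.pi / 2) * Real.exp (-b * x) * Real.sinh (a * x))) := by
  have hint : ∀ c R : ℝ, IntervalIntegrable
      (fun t : ℝ => t * Real.sin (c * t) / (x ^ 2 + t ^ 2)) volume 0 R := fun c R => by
    refine Continuous.intervalIntegrable ?_ _ _
    fun_prop (disch := intros; positivity)
  have hprod : ∀ t : ℝ, t * Real.cos (b * t) * Real.sin (a * t) / (x ^ 2 + t ^ 2) =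
      2⁻¹ * (t * Real.sin ((b + a) * t) / (x ^ 2 + t ^ 2) -
        t * Real.sin ((b - a) * t) / (x ^ 2 + t ^ 2)) := fun t => by
    rw [add_mul, sub_mul, Real.sin_add, Real.sin_sub]
    ring
  simp_rw [hprod, intervalIntegral.integral_const_mul,
    intervalIntegral.integral_sub (hint _ _) (hint _ _)]
  convert! ((tendsto_integral_mul_sin_div_sq_add_sq hx (c := b + a) (by linarith)).sub
    (tendsto_integral_mul_sin_div_sq_add_sq hx (sub_pos.2 hab))).const_mul 2⁻¹ using 2
  rw [Real.sinh_eq, show -x * (b + a) = -b * x + -(a * x) by ring,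
    show -x * (b - a) = -b * x + a * x by ring, Real.exp_add, Real.exp_add]
  ring
end

section
/- For all a > 0 and x > 0, the principal value integral over t in (0, ∞) of sec(a t) / (x² + t²) dt equals π / (2 x · cosh(a x)). -/
open Real MeasureTheory Filter intervalIntegral

/-- `IsPVIntegral f p L` means the principal value of `∫₀^∞ f`, where `f` has
simple poles at the increasing sequence `p k`, equals `L`: for each sufficiently
small `ε > 0` one sums the integrals over the pole-free gaps (each pole shielded
by an `ε`-neighborhood), takes the limit over the number `N` of gaps, and this
value tends to `L` as `ε → 0⁺`. -/
def IsPVIntegral (f : ℝ → ℝ) (p : ℕ → ℝ) (L : ℝ) : Prop :=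
  ∃ ε₀ > (0:ℝ), ∃ F : ℝ → ℝ,
    (∀ ε ∈ Set.Ioo (0:ℝ) ε₀,
      Filter.Tendsto (fun N : ℕ =>
          (∫ t in (0:ℝ)..(p 0 - ε), f t) +
            ∑ k ∈ Finset.range N, ∫ t in (p k + ε)..(p (k + 1) - ε), f t)
        Filter.atTop (nhds (F ε))) ∧
    Filter.Tendsto F (nhdsWithin 0 (Set.Ioi 0)) (nhds L)

/-- The Mittag-Leffler expansion of the cosecant, off the real axis. -/
lemma hasSum_cosec_mittagLeffler {z : ℂ} (hz : z.im ≠ 0) :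
    HasSum (fun n : ℕ => (-1 : ℂ) ^ (n + 1) * (1 / (z - (n + 1)) + 1 / (z + (n + 1))))
      (π / Complex.sin (π * z) - 1 / z) := by
  have key : ∀ w : ℂ, w.im ≠ 0 → w ∈ Complex.integerComplement ∧
      HasSum (fun n : ℕ => 1 / (w - (n + 1)) + 1 / (w + (n + 1)))
        (π * Complex.cot (π * w) - 1 / w) := by
    intro w hw
    have hmem : w ∈ Complex.integerComplement := by
      rintro ⟨n, rfl⟩
      simp at hw
    refine ⟨hmem, ?_⟩
    rw [cot_series_rep' hmem]
    exact (summable_cotTerm hmem).hasSum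
  obtain ⟨hm1, h1⟩ := key z hz
  obtain ⟨hm2, h2⟩ := key (z / 2) (by simpa using hz)
  have hinj : Function.Injective (fun n : ℕ => 2 * n + 1) := fun m n h => by
    simpa using h
  have h3 : HasSum (fun n : ℕ => (1 - (-1 : ℂ) ^ n) *
      (1 / (z - (n + 1)) + 1 / (z + (n + 1)))) (π * Complex.cot (π * (z / 2)) - 1 / (z / 2)) := by
    rw [← hinj.hasSum_iff]
    · convert! h2 using 2 with n
      have e1 : z / 2 - (n + 1) = (z - (2 * n + 1 + 1)) / 2 := by ring
      have e2 : z / 2 + (n + 1) = (z + (2 * n + 1 + 1)) / 2 := by ring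
      simp only [Function.comp, e1, e2, pow_succ, pow_mul, one_div, inv_div]
      push_cast
      norm_num
      ring
    · intro n hn
      have : Even n := by
        by_contra h
        obtain ⟨m, rfl⟩ := Nat.not_even_iff_odd.1 h
        exact hn ⟨m, rfl⟩
      simp [this.neg_one_pow]
  convert! h3.sub h1 using 1
  · ext n
    ring
  · have hs1 := sin_pi_mul_ne_zero hm1
    have hs2 := sin_pi_mul_ne_zero hm2
    have hz0 : z ≠ 0 := by rintro rfl; simp at hz
    have e : (π : ℂ) * z = 2 * (π * (z / 2)) := by ring
    rw [e] at hs1 ⊢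
    generalize (π : ℂ) * (z / 2) = v at *
    rw [Complex.sin_two_mul] at hs1
    have hc : Complex.cos v ≠ 0 := right_ne_zero_of_mul hs1
    rw [Complex.cot, Complex.cot, Complex.sin_two_mul, Complex.cos_two_mul]
    field_simp
    ring

/-- The alternating series of shifted Cauchy kernels, in closed form. -/
lemma hasSum_alternating_cauchy_kernel {a x : ℝ} (ha : 0 < a) (hx : 0 < x) (s : ℝ) :
    HasSum (fun n : ℕ => (-1 : ℝ) ^ (n + 1) * (1 / (x ^ 2 + ((n + 1) * π / a + s) ^ 2) +
        1 / (x ^ 2 + ((n + 1) * π / a - s) ^ 2)))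
      (a / x * (cos (a * s) * sinh (a * x)) /
        (sin (a * s) ^ 2 * cosh (a * x) ^ 2 + cos (a * s) ^ 2 * sinh (a * x) ^ 2)
        - 1 / (x ^ 2 + s ^ 2)) := by
  have hπ := Real.pi_pos
  set z : ℂ := ⟨a * s / π, a * x / π⟩ with hzdef
  have hz : z.im ≠ 0 := by simp only [hzdef]; positivity
  have inv_im : ∀ r : ℝ, ((z + r)⁻¹).im = -(π * x / a) / (x ^ 2 + (r * π / a + s) ^ 2) := by
    intro r
    have h1 : Complex.normSq (z + r) = (a / π) ^ 2 * (x ^ 2 + (r * π / a + s) ^ 2) := by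
      rw [Complex.normSq_apply]
      simp only [hzdef, Complex.add_re, Complex.add_im, Complex.ofReal_re, Complex.ofReal_im]
      field_simp
      ring
    have : x ^ 2 + (r * π / a + s) ^ 2 ≠ 0 := by positivity
    rw [Complex.inv_im, h1]
    simp only [hzdef, Complex.add_im, Complex.ofReal_im]
    generalize x ^ 2 + (r * π / a + s) ^ 2 = d at *
    field_simp
    ring
  have hsin : (π / Complex.sin (π * z)).im = -π * (cos (a * s) * sinh (a * x)) /
      (sin (a * s) ^ 2 * cosh (a * x) ^ 2 + cos (a * s) ^ 2 * sinh (a * x) ^ 2) := by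
    have e : (π : ℂ) * z = ((a * s : ℝ) : ℂ) + ((a * x : ℝ) : ℂ) * Complex.I := by
      apply Complex.ext <;> simp [hzdef] <;> field_simp
    have e2 : Complex.sin (π * z) =
        ⟨sin (a * s) * cosh (a * x), cos (a * s) * sinh (a * x)⟩ := by
      rw [e, Complex.sin_add_mul_I, ← Complex.ofReal_sin, ← Complex.ofReal_cosh,
        ← Complex.ofReal_cos, ← Complex.ofReal_sinh]
      apply Complex.ext <;> simp [-Complex.ofReal_sin, -Complex.ofReal_cosh,
        -Complex.ofReal_cos, -Complex.ofReal_sinh]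
    rw [e2, div_eq_mul_inv, Complex.im_ofReal_mul, Complex.inv_im, Complex.normSq_apply]
    ring
  have H := (Complex.hasSum_im (hasSum_cosec_mittagLeffler hz)).mul_left (-(a / (π * x)))
  convert! H using 1
  · ext n
    have e1 : ((-1 : ℂ) ^ (n + 1)) = (((-1 : ℝ) ^ (n + 1) : ℝ) : ℂ) := by push_cast; rfl
    have i1 := inv_im (n + 1)
    have i2 := inv_im (-(n + 1))
    push_cast at i1 i2
    rw [← sub_eq_add_neg] at i2
    rw [e1, Complex.im_ofReal_mul, Complex.add_im, one_div (z - _), one_div (z + _), i1, i2,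
      show (-((n : ℝ) + 1) * π / a + s) ^ 2 = ((n + 1) * π / a - s) ^ 2 by ring]
    have d1 : x ^ 2 + ((n + 1) * π / a + s) ^ 2 ≠ 0 := by positivity
    have d2 : x ^ 2 + ((n + 1) * π / a - s) ^ 2 ≠ 0 := by positivity
    generalize x ^ 2 + ((n + 1) * π / a + s) ^ 2 = u at *
    generalize x ^ 2 + ((n + 1) * π / a - s) ^ 2 = v at *
    field_simp
    ring
  · have i0 := inv_im 0
    simp only [Complex.ofReal_zero, add_zero, zero_mul, zero_div, zero_add] at i0
    rw [Complex.sub_im, hsin, one_div z, i0]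
    have d1 : x ^ 2 + s ^ 2 ≠ 0 := by positivity
    generalize sin (a * s) ^ 2 * cosh (a * x) ^ 2 + cos (a * s) ^ 2 * sinh (a * x) ^ 2 = D
    rw [mul_sub, neg_mul, neg_mul, neg_div, neg_div]
    congr 1
    · rw [mul_neg, neg_neg]
      field_simp
    · field_simp

lemma cos_pos_of_abs_le {a c : ℝ} (ha : 0 < a) (hc : c < π / (2 * a)) {s : ℝ} (hs : |s| ≤ c) :
    0 < cos (a * s) := by
  have h := abs_le.1 hs
  rw [lt_div_iff₀ (by positivity)] at hc
  apply cos_pos_of_mem_Ioo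
  constructor <;> nlinarith

/-- The integral over a symmetric gap around `(k + 1) π / a`, folded onto `[0, c]`. -/
lemma integral_gap {a x c : ℝ} (ha : 0 < a) (hx : 0 < x) (hc0 : 0 < c)
    (hc : c < π / (2 * a)) (k : ℕ) :
    ∫ t in ((k + 1) * π / a - c)..((k + 1) * π / a + c), 1 / (cos (a * t) * (x ^ 2 + t ^ 2)) =
      ∫ s in (0 : ℝ)..c, 1 / cos (a * s) * ((-1 : ℝ) ^ (k + 1) *
        (1 / (x ^ 2 + ((k + 1) * π / a + s) ^ 2) + 1 / (x ^ 2 + ((k + 1) * π / a - s) ^ 2))) := by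
  set m : ℝ := (k + 1) * π / a with hm
  set w : ℝ → ℝ := fun s =>
    1 / cos (a * s) * ((-1 : ℝ) ^ (k + 1) * (1 / (x ^ 2 + (m + s) ^ 2))) with hw
  have hcont : ContinuousOn w (Set.Icc (-c) c) := by
    intro s hs
    have h1 := (cos_pos_of_abs_le ha hc (abs_le.2 hs)).ne'
    have h2 : x ^ 2 + (m + s) ^ 2 ≠ 0 := by positivity
    apply ContinuousAt.continuousWithinAt
    fun_prop (disch := assumption)
  have hint : ∀ u v, u ∈ Set.Icc (-c) c → v ∈ Set.Icc (-c) c → IntervalIntegrable w volume u v :=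
    fun u v hu hv => (hcont.mono (Set.uIcc_subset_Icc hu hv)).intervalIntegrable
  have hl : -c ∈ Set.Icc (-c) c := ⟨le_rfl, by linarith⟩
  have h0 : (0 : ℝ) ∈ Set.Icc (-c) c := ⟨by linarith, hc0.le⟩
  have hr : c ∈ Set.Icc (-c) c := ⟨by linarith, le_rfl⟩
  have hshift : ∫ t in (m - c)..(m + c), 1 / (cos (a * t) * (x ^ 2 + t ^ 2)) =
      ∫ s in (-c)..c, w s := by
    rw [sub_eq_add_neg, ← intervalIntegral.integral_comp_add_left]
    congr 1
    ext s
    have e : a * (m + s) = a * s + (k + 1 : ℕ) * π := by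
      rw [hm]; push_cast; field_simp; ring
    have e2 : ((-1 : ℝ) ^ (k + 1))⁻¹ = (-1) ^ (k + 1) := by rw [← inv_pow]; norm_num
    rw [e, cos_add_nat_mul_pi]
    simp only [hw, one_div, mul_inv, e2]
    ring
  have hneg : ∫ s in (-c)..0, w s = ∫ s in (0 : ℝ)..c, w (-s) := by
    rw [intervalIntegral.integral_comp_neg, neg_zero]
  have hint' : IntervalIntegrable (fun s => w (-s)) volume 0 c := by
    apply ContinuousOn.intervalIntegrable
    refine hcont.comp continuousOn_neg ?_
    rw [Set.uIcc_of_le hc0.le]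
    intro s hs
    exact ⟨by linarith [hs.2], by linarith [hs.1]⟩
  rw [hshift, ← integral_add_adjacent_intervals (hint _ _ hl h0) (hint _ _ h0 hr), hneg,
    ← intervalIntegral.integral_add hint' (hint _ _ h0 hr)]
  congr 1
  ext s
  simp only [hw, mul_neg, cos_neg]
  ring

lemma sin_sq_cosh_sq_add_pos (u : ℝ) {b : ℝ} (hb : 0 < b) :
    0 < sin u ^ 2 * cosh b ^ 2 + cos u ^ 2 * sinh b ^ 2 := by
  have h1 : 0 < sinh b ^ 2 := pow_pos (sinh_pos_iff.2 hb) 2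
  nlinarith [sin_sq_add_cos_sq u, cosh_sq b, sq_nonneg (sin u)]

/-- Summing the contributions of all the gaps. -/
lemma hasSum_integral_gap {a x c : ℝ} (ha : 0 < a) (hx : 0 < x) (hc0 : 0 < c)
    (hc : c < π / (2 * a)) :
    HasSum (fun k : ℕ => ∫ s in (0 : ℝ)..c, 1 / cos (a * s) * ((-1 : ℝ) ^ (k + 1) *
        (1 / (x ^ 2 + ((k + 1) * π / a + s) ^ 2) + 1 / (x ^ 2 + ((k + 1) * π / a - s) ^ 2))))
      (∫ s in (0 : ℝ)..c, 1 / cos (a * s) * (a / x * (cos (a * s) * sinh (a * x)) /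
        (sin (a * s) ^ 2 * cosh (a * x) ^ 2 + cos (a * s) ^ 2 * sinh (a * x) ^ 2)
        - 1 / (x ^ 2 + s ^ 2))) := by
  have hπ := Real.pi_pos
  have hsec : ContinuousOn (fun s => 1 / cos (a * s)) (Set.Icc 0 c) := by
    intro s hs
    have h1 := (cos_pos_of_abs_le ha hc (s := s) (by rw [abs_of_nonneg hs.1]; exact hs.2)).ne'
    apply ContinuousAt.continuousWithinAt
    fun_prop (disch := assumption)
  obtain ⟨C, hC⟩ := isCompact_Icc.exists_bound_of_continuousOn hsec
  have hmem : ∀ s, s ∈ Set.uIoc 0 c → s ∈ Set.Icc 0 c := fun s hs => by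
    rw [Set.uIoc_of_le hc0.le] at hs
    exact ⟨hs.1.le, hs.2⟩
  have hsum : Summable (fun k : ℕ => C * (2 * ((2 * a / π) ^ 2 * (1 / ((k + 1 : ℕ) : ℝ) ^ 2)))) :=
    ((((summable_nat_add_iff 1).2
      (Real.summable_one_div_nat_pow.2 one_lt_two)).mul_left _).mul_left _).mul_left _
  refine intervalIntegral.hasSum_integral_of_dominated_convergence
    (fun k _ => C * (2 * ((2 * a / π) ^ 2 * (1 / ((k + 1 : ℕ) : ℝ) ^ 2)))) ?_ ?_ ?_ ?_ ?_
  · intro k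
    have : Measurable (fun s : ℝ => 1 / cos (a * s) * ((-1 : ℝ) ^ (k + 1) *
        (1 / (x ^ 2 + ((k + 1) * π / a + s) ^ 2) + 1 / (x ^ 2 + ((k + 1) * π / a - s) ^ 2)))) := by
      fun_prop
    exact this.aestronglyMeasurable
  · refine fun k => ae_of_all _ fun s hs => ?_
    have hs' := hmem s hs
    have hq : (k + 1) * π / (2 * a) ≤ (k + 1) * π / a - s := by
      have h1 : s ≤ (k + 1) * π / (2 * a) := by
        refine (hs'.2.trans hc.le).trans ?_
        gcongr
        nlinarith [(Nat.cast_nonneg k : (0 : ℝ) ≤ k)]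
      have h2 : (k + 1) * π / a = (k + 1) * π / (2 * a) + (k + 1) * π / (2 * a) := by
        field_simp; ring
      linarith
    have hq0 : 0 < (k + 1) * π / (2 * a) := by positivity
    have hb : ∀ y, (k + 1) * π / (2 * a) ≤ y →
        1 / (x ^ 2 + y ^ 2) ≤ (2 * a / π) ^ 2 * (1 / ((k + 1 : ℕ) : ℝ) ^ 2) := by
      intro y hy
      calc 1 / (x ^ 2 + y ^ 2) ≤ 1 / ((k + 1) * π / (2 * a)) ^ 2 := by
            apply one_div_le_one_div_of_le (by positivity)
            nlinarith
        _ = _ := by push_cast; field_simp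
    rw [norm_mul, norm_mul, norm_pow, norm_neg, norm_one, one_pow, one_mul,
      Real.norm_of_nonneg (r := _ + _) (by positivity)]
    have hC0 := (norm_nonneg _).trans (hC s hs')
    refine mul_le_mul (hC s hs') ?_ (by positivity) hC0
    have := hb _ hq
    have := hb ((k + 1) * π / a + s) (by linarith [hs'.1])
    linarith
  · exact ae_of_all _ fun s _ => hsum
  · exact intervalIntegrable_const
  · exact ae_of_all _ fun s _ => (hasSum_alternating_cauchy_kernel ha hx s).mul_left _

lemma integral_sinh_div {a x c : ℝ} (ha : 0 < a) (hx : 0 < x) (hc0 : 0 < c)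
    (hc : c < π / (2 * a)) :
    ∫ s in (0 : ℝ)..c, a / x * sinh (a * x) /
        (sin (a * s) ^ 2 * cosh (a * x) ^ 2 + cos (a * s) ^ 2 * sinh (a * x) ^ 2) =
      1 / (x * cosh (a * x)) * arctan (cosh (a * x) / sinh (a * x) * tan (a * c)) := by
  have hS : 0 < sinh (a * x) := sinh_pos_iff.2 (by positivity)
  have hC := cosh_pos (a * x)
  rw [integral_eq_sub_of_hasDerivAt (f := fun s =>
    1 / (x * cosh (a * x)) * arctan (cosh (a * x) / sinh (a * x) * tan (a * s)))]
  · simp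
  · intro s hs
    rw [Set.uIcc_of_le hc0.le] at hs
    have h1 := (cos_pos_of_abs_le ha hc (s := s) (by rw [abs_of_nonneg hs.1]; exact hs.2)).ne'
    have hd := (sin_sq_cosh_sq_add_pos (a * s) (b := a * x) (by positivity)).ne'
    have hlin : HasDerivAt (fun s => a * s) a s := by simpa using (hasDerivAt_id s).const_mul a
    have h2 := ((((hasDerivAt_tan h1).comp s hlin).const_mul
      (cosh (a * x) / sinh (a * x))).arctan).const_mul (1 / (x * cosh (a * x)))
    convert! h2 using 1
    simp only [Function.comp]
    have e : 1 + (cosh (a * x) / sinh (a * x) * tan (a * s)) ^ 2 =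
        (sin (a * s) ^ 2 * cosh (a * x) ^ 2 + cos (a * s) ^ 2 * sinh (a * x) ^ 2) /
          (cos (a * s) ^ 2 * sinh (a * x) ^ 2) := by
      rw [tan_eq_sin_div_cos]
      field_simp
      ring
    rw [e]
    generalize sin (a * s) ^ 2 * cosh (a * x) ^ 2 + cos (a * s) ^ 2 * sinh (a * x) ^ 2 = D at *
    field_simp
  · apply Continuous.intervalIntegrable
    have hd := fun s => (sin_sq_cosh_sq_add_pos (a * s) (b := a * x) (by positivity)).ne'
    fun_prop (disch := exact hd)

theorem pv_sec (a x : ℝ) (ha : 0 < a) (hx : 0 < x) :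
    IsPVIntegral (fun t => 1 / (Real.cos (a * t) * (x ^ 2 + t ^ 2))) (fun k => (2 * (k : ℝ) + 1) * Real.pi / (2 * a)) (Real.pi / (2 * x * Real.cosh (a * x))) := by
  have hπ := Real.pi_pos
  have hS : 0 < sinh (a * x) := sinh_pos_iff.2 (by positivity)
  have hC := cosh_pos (a * x)
  refine ⟨π / (2 * a), by positivity, fun ε => 1 / (x * cosh (a * x)) *
    arctan (cosh (a * x) / sinh (a * x) * tan (a * (π / (2 * a) - ε))), ?_, ?_⟩
  · intro ε hε
    have hc0 : 0 < π / (2 * a) - ε := sub_pos.2 hε.2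
    have hc : π / (2 * a) - ε < π / (2 * a) := sub_lt_self _ hε.1
    have hgap : ∀ k : ℕ, ∫ t in ((2 * (k : ℝ) + 1) * π / (2 * a) + ε)..
        ((2 * ((k + 1 : ℕ) : ℝ) + 1) * π / (2 * a) - ε), 1 / (cos (a * t) * (x ^ 2 + t ^ 2)) = _ :=
      fun k => by
        refine Eq.trans ?_ (integral_gap ha hx hc0 hc k)
        congr 1
        · field_simp; ring
        · push_cast; field_simp; ring
    have hfirst : (2 * ((0 : ℕ) : ℝ) + 1) * π / (2 * a) - ε = π / (2 * a) - ε := by simp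
    simp only [hgap, hfirst]
    rw [← integral_sinh_div ha hx hc0 hc]
    generalize π / (2 * a) - ε = c at *
    have hcos : ∀ s ∈ Set.uIcc 0 c, cos (a * s) ≠ 0 := fun s hs => by
      rw [Set.uIcc_of_le hc0.le] at hs
      exact (cos_pos_of_abs_le ha hc (by rw [abs_of_nonneg hs.1]; exact hs.2)).ne'
    have hi1 : IntervalIntegrable (fun s => 1 / (cos (a * s) * (x ^ 2 + s ^ 2))) volume 0 c := by
      apply ContinuousOn.intervalIntegrable
      intro s hs
      have h1 : cos (a * s) * (x ^ 2 + s ^ 2) ≠ 0 := mul_ne_zero (hcos s hs) (by positivity)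
      apply ContinuousAt.continuousWithinAt
      fun_prop (disch := assumption)
    have hi2 : IntervalIntegrable (fun s => a / x * sinh (a * x) /
        (sin (a * s) ^ 2 * cosh (a * x) ^ 2 + cos (a * s) ^ 2 * sinh (a * x) ^ 2)) volume 0 c := by
      apply Continuous.intervalIntegrable
      have hd := fun s => (sin_sq_cosh_sq_add_pos (a * s) (b := a * x) (by positivity)).ne'
      fun_prop (disch := exact hd)
    have hlim := (hasSum_integral_gap ha hx hc0 hc).tendsto_sum_nat.const_add
      (∫ s in (0 : ℝ)..c, 1 / (cos (a * s) * (x ^ 2 + s ^ 2)))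
    convert hlim using 2
    rw [eq_comm, ← eq_sub_iff_add_eq', ← intervalIntegral.integral_sub hi2 hi1]
    apply intervalIntegral.integral_congr
    intro s hs
    have h1 := hcos s hs
    have h2 : x ^ 2 + s ^ 2 ≠ 0 := by positivity
    have hd := (sin_sq_cosh_sq_add_pos (a * s) (b := a * x) (by positivity)).ne'
    simp only
    generalize sin (a * s) ^ 2 * cosh (a * x) ^ 2 + cos (a * s) ^ 2 * sinh (a * x) ^ 2 = D at *
    field_simp
  · have hto : Tendsto (fun ε => a * (π / (2 * a) - ε)) (nhdsWithin 0 (Set.Ioi 0))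
        (nhdsWithin (π / 2) (Set.Iio (π / 2))) := by
      have e : a * (π / (2 * a) - 0) = π / 2 := by field_simp; simp
      refine tendsto_nhdsWithin_iff.2 ⟨?_, ?_⟩
      · have : Continuous (fun ε => a * (π / (2 * a) - ε)) := by fun_prop
        have h := this.tendsto 0
        rw [e] at h
        exact h.mono_left nhdsWithin_le_nhds
      · filter_upwards [self_mem_nhdsWithin] with ε hε
        rw [Set.mem_Iio, ← e]
        have : (0 : ℝ) < ε := hε
        gcongr
    have h := ((tendsto_arctan_atTop.mono_right nhdsWithin_le_nhds).comp
      ((tendsto_tan_pi_div_two.comp hto).const_mul_atTop (div_pos hC hS))).const_mul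
        (1 / (x * cosh (a * x)))
    have e : π / (2 * x * cosh (a * x)) = 1 / (x * cosh (a * x)) * (π / 2) := by field_simp
    rw [e]
    exact h
end

section
/- For all a > 0 and x > 0, the principal value integral over t in (0, ∞) of t / (sin(a t) · (x² + t²)) dt equals π / (2·sinh(a x)). -/
open Real MeasureTheory Filter intervalIntegral

open Complex in
/-- Mittag-Leffler expansion of the cosecant. -/
theorem hasSum_pi_div_sin {w : ℂ} (hw : w ∈ integerComplement) (hw2 : w / 2 ∈ integerComplement) :
    HasSum (fun n : ℕ => (-1 : ℂ) ^ (n + 1) * (1 / (w - (n + 1)) + 1 / (w + (n + 1))))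
      (π / Complex.sin (π * w) - 1 / w) := by
  have hS := summable_cotTerm hw
  have hE : HasSum (fun m : ℕ => cotTerm w (2 * m + 1))
      (1 / 2 * (π * Complex.cot (π * (w / 2)) - 1 / (w / 2))) := by
    have h := (summable_cotTerm hw2).hasSum
    simp only [cotTerm] at h
    rw [← cot_series_rep' hw2] at h
    refine (h.mul_left (1 / 2)).congr_fun fun m => ?_
    have h1 : w / 2 - (m + 1) = (w - ((2 * m + 1 : ℕ) + 1)) / 2 := by push_cast; ring
    have h2 : w / 2 + (m + 1) = (w + ((2 * m + 1 : ℕ) + 1)) / 2 := by push_cast; ring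
    rw [h1, h2, cotTerm, one_div_div, one_div_div]
    ring
  have hO : Summable (fun m : ℕ => cotTerm w (2 * m)) :=
    hS.comp_injective (mul_right_injective₀ two_ne_zero)
  have hsum : ∑' m : ℕ, cotTerm w (2 * m) +
      1 / 2 * (π * Complex.cot (π * (w / 2)) - 1 / (w / 2)) = π * Complex.cot (π * w) - 1 / w := by
    rw [cot_series_rep' hw]
    exact ((hO.hasSum.even_add_odd hE).tsum_eq).symm
  have key : HasSum (fun n : ℕ => (-1 : ℂ) ^ (n + 1) * cotTerm w n)
      (-∑' m : ℕ, cotTerm w (2 * m) + 1 / 2 * (π * Complex.cot (π * (w / 2)) - 1 / (w / 2))) := by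
    refine HasSum.even_add_odd ?_ ?_
    · refine hO.hasSum.neg.congr_fun fun m => ?_
      rw [(show Odd (2 * m + 1) from ⟨m, rfl⟩).neg_one_pow, neg_one_mul]
    · refine hE.congr_fun fun m => ?_
      rw [(show Even (2 * m + 1 + 1) from ⟨m + 1, by ring⟩).neg_one_pow, one_mul]
  convert key using 1
  rw [eq_sub_of_add_eq hsum]
  have hs := sin_pi_mul_ne_zero hw
  have hs2 := sin_pi_mul_ne_zero hw2
  have hw0 := integerComplement.ne_zero hw
  have e : (π : ℂ) * w = 2 * (π * (w / 2)) := by ring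
  rw [Complex.cot, Complex.cot]
  rw [e] at hs ⊢
  rw [Complex.sin_two_mul] at hs ⊢
  rw [Complex.cos_two_mul]
  generalize (π : ℂ) * (w / 2) = y at *
  have hc : Complex.cos y ≠ 0 := fun h => hs (by simp [h])
  field_simp
  ring

theorem hasSum_alternating_kernel {c x s : ℝ} (hc : 0 < c) (hx : 0 < x) :
    HasSum (fun n : ℕ => (-1 : ℝ) ^ (n + 1) *
        ((s + (n + 1) * c) / (x ^ 2 + (s + (n + 1) * c) ^ 2) +
          (s - (n + 1) * c) / (x ^ 2 + (s - (n + 1) * c) ^ 2)))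
      (π / c * Real.sin (π / c * s) * Real.cosh (π / c * x) /
        (Real.sin (π / c * s) ^ 2 + Real.sinh (π / c * x) ^ 2) - s / (x ^ 2 + s ^ 2)) := by
  have hint : ∀ v : ℂ, v.im ≠ 0 → v ∈ Complex.integerComplement := by
    rintro v hv ⟨n, rfl⟩
    simp at hv
  have hre : ∀ t : ℝ, (1 / ((t : ℂ) + x * Complex.I)).re = t / (x ^ 2 + t ^ 2) := by
    intro t
    simp [Complex.normSq_apply, Complex.inv_re]
    ring
  set w : ℂ := (s + x * Complex.I) / c with hwdef
  have hcC : (c : ℂ) ≠ 0 := by exact_mod_cast hc.ne'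
  have him : w.im ≠ 0 := by
    simp [hwdef, hx.ne', hc.ne']
  have h := (hasSum_pi_div_sin (hint w him) (hint (w / 2) (by simpa using him))).mul_left
    (1 / (c : ℂ))
  have h2 := Complex.reCLM.hasSum h
  convert h2 using 1
  · ext n
    have e1 : 1 / (w - (n + 1)) = c * (1 / (((s - (n + 1) * c : ℝ) : ℂ) + x * Complex.I)) := by
      have : w - (n + 1) = (((s - (n + 1) * c : ℝ) : ℂ) + x * Complex.I) / c := by
        rw [hwdef]; push_cast; field_simp; ring
      rw [this, one_div_div]; ring
    have e2 : 1 / (w + (n + 1)) = c * (1 / (((s + (n + 1) * c : ℝ) : ℂ) + x * Complex.I)) := by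
      have : w + (n + 1) = (((s + (n + 1) * c : ℝ) : ℂ) + x * Complex.I) / c := by
        rw [hwdef]; push_cast; field_simp; ring
      rw [this, one_div_div]; ring
    rw [e1, e2, ← hre, ← hre]
    simp only [Complex.reCLM_apply]
    rw [show ∀ A B : ℂ, 1 / (c : ℂ) * ((-1) ^ (n + 1) * (c * A + c * B)) =
      (((-1) ^ (n + 1) : ℝ) : ℂ) * (B + A) by intro A B; push_cast; field_simp; ring]
    rw [Complex.re_ofReal_mul, Complex.add_re]
  · have e1 : 1 / (c : ℂ) * (π / Complex.sin (π * w) - 1 / w) =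
        ((π / c : ℝ) : ℂ) * (1 / Complex.sin (((π / c * s : ℝ) : ℂ) + (π / c * x : ℝ) * Complex.I)) -
          1 / (s + x * Complex.I) := by
      have : (π : ℂ) * w = ((π / c * s : ℝ) : ℂ) + (π / c * x : ℝ) * Complex.I := by
        rw [hwdef]; push_cast; ring
      rw [this, hwdef, one_div_div]
      push_cast
      field_simp
    rw [e1]
    simp only [Complex.reCLM_apply]
    rw [Complex.sub_re, hre, Complex.re_ofReal_mul, Complex.sin_add_mul_I]
    generalize π / c * s = u
    generalize π / c * x = v
    rw [← Complex.ofReal_sin, ← Complex.ofReal_cos, ← Complex.ofReal_sinh, ← Complex.ofReal_cosh,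
      ← Complex.ofReal_mul, ← Complex.ofReal_mul]
    have : Real.sin u ^ 2 + Real.sinh v ^ 2 = (Real.sin u * Real.cosh v) ^ 2 +
        (Real.cos u * Real.sinh v) ^ 2 := by
      rw [mul_pow, mul_pow, Real.cosh_sq, Real.cos_sq']; ring
    rw [this, one_div, Complex.inv_re]
    generalize Real.sin u = A, Real.cos u = B, Real.sinh v = C, Real.cosh v = D
    simp [Complex.normSq_apply]
    ring

theorem abs_div_sub_div_le {x m u v : ℝ} (hm : 0 < m) (hu : m ≤ x ^ 2 + u ^ 2)
    (hv : m ≤ x ^ 2 + v ^ 2) :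
    |u / (x ^ 2 + u ^ 2) - v / (x ^ 2 + v ^ 2)| ≤ |u - v| / m := by
  have hA : 0 < x ^ 2 + u ^ 2 := hm.trans_le hu
  have hB : 0 < x ^ 2 + v ^ 2 := hm.trans_le hv
  have e : u / (x ^ 2 + u ^ 2) - v / (x ^ 2 + v ^ 2) =
      (u - v) * ((x ^ 2 - u * v) / ((x ^ 2 + u ^ 2) * (x ^ 2 + v ^ 2))) := by
    field_simp
    ring
  rw [e, abs_mul, div_eq_mul_one_div |u - v|]
  refine mul_le_mul_of_nonneg_left ?_ (abs_nonneg _)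
  rw [abs_div, abs_of_pos (mul_pos hA hB), div_le_div_iff₀ (mul_pos hA hB) hm, one_mul]
  have h1 : |x ^ 2 - u * v| ^ 2 ≤ (x ^ 2 + u ^ 2) * (x ^ 2 + v ^ 2) := by
    rw [sq_abs]
    nlinarith [sq_nonneg (x * (u + v))]
  have h2 : m ^ 2 ≤ (x ^ 2 + u ^ 2) * (x ^ 2 + v ^ 2) := by
    rw [sq]
    gcongr
  refine le_of_sq_le_sq ?_ (mul_pos hA hB).le
  rw [mul_pow, sq ((x ^ 2 + u ^ 2) * (x ^ 2 + v ^ 2))]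
  gcongr

theorem abs_kernel_pair_le {c x s : ℝ} (hc : 0 < c) (hx : 0 < x) (hs : s ∈ Set.Icc 0 c) (n : ℕ) :
    |(s + (n + 1) * c) / (x ^ 2 + (s + (n + 1) * c) ^ 2) +
      (s - (n + 1) * c) / (x ^ 2 + (s - (n + 1) * c) ^ 2)| ≤ 2 * c / (x ^ 2 + (n * c) ^ 2) := by
  obtain ⟨h0, h1⟩ := hs
  have hn : (0 : ℝ) ≤ n * c := by positivity
  have hm : 0 < x ^ 2 + (n * c) ^ 2 := by positivity
  have key := abs_div_sub_div_le (x := x) (u := (n + 1) * c + s) (v := (n + 1) * c - s) hm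
    (by gcongr; linarith) (by gcongr; linarith)
  have e : (s + (n + 1) * c) / (x ^ 2 + (s + (n + 1) * c) ^ 2) +
      (s - (n + 1) * c) / (x ^ 2 + (s - (n + 1) * c) ^ 2) =
      ((n + 1) * c + s) / (x ^ 2 + ((n + 1) * c + s) ^ 2) -
        ((n + 1) * c - s) / (x ^ 2 + ((n + 1) * c - s) ^ 2) := by
    rw [← neg_sub ((n + 1) * c) s, neg_sq, neg_div, add_comm s, ← sub_eq_add_neg]
  rw [e]
  refine key.trans ?_
  gcongr
  rw [abs_le]
  constructor <;> linarith

theorem summable_kernel_bound {c x : ℝ} (hc : 0 < c) :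
    Summable fun n : ℕ => 2 * c / (x ^ 2 + (n * c) ^ 2) := by
  refine Summable.of_norm_bounded_eventually_nat
    ((Real.summable_one_div_nat_pow.2 one_lt_two).mul_left (2 / c)) ?_
  filter_upwards [eventually_gt_atTop 0] with n hn
  have hn' : (0 : ℝ) < n := by exact_mod_cast hn
  rw [Real.norm_of_nonneg (by positivity), div_mul_div_comm, mul_one,
    div_le_div_iff₀ (by positivity) (by positivity)]
  nlinarith [mul_nonneg hc.le (sq_nonneg x), sq_nonneg x]

theorem abs_div_sq_add_sq_le {x t : ℝ} (ht : 0 < t) : |t / (x ^ 2 + t ^ 2)| ≤ 1 / t := by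
  rw [abs_of_nonneg (by positivity), div_le_div_iff₀ (by positivity) ht]
  nlinarith [sq_nonneg x]

theorem integral_cosh_div {a x : ℝ} (ha : 0 < a) (hx : 0 < x) :
    ∫ s in (0 : ℝ)..π / a, a * Real.cosh (a * x) / (Real.sin (a * s) ^ 2 + Real.sinh (a * x) ^ 2) =
      π / Real.sinh (a * x) := by
  have hS : 0 < Real.sinh (a * x) := Real.sinh_pos_iff.2 (mul_pos ha hx)
  have hC : 0 < Real.cosh (a * x) := Real.cosh_pos _
  have hCS : Real.cosh (a * x) ^ 2 = Real.sinh (a * x) ^ 2 + 1 := Real.cosh_sq _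
  generalize Real.sinh (a * x) = S at *
  generalize Real.cosh (a * x) = C at *
  have hD : ∀ u : ℝ, 0 < S * Real.cos u ^ 2 + C * Real.sin u ^ 2 := by
    intro u
    rcases eq_or_ne (Real.sin u) 0 with h | h
    · have : Real.cos u ^ 2 = 1 := by rw [Real.cos_sq', h]; ring
      rw [this, h]
      simpa using hS
    · positivity
  have hder : ∀ s : ℝ, HasDerivAt
      (fun s => (a * s + Real.arctan ((C - S) * (Real.sin (a * s) * Real.cos (a * s)) /
        (S * Real.cos (a * s) ^ 2 + C * Real.sin (a * s) ^ 2))) / S)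
      (a * C / (Real.sin (a * s) ^ 2 + S ^ 2)) s := by
    intro s
    have h0 : HasDerivAt (fun s => a * s) a s := by simpa using (hasDerivAt_id s).const_mul a
    have hsin := h0.sin
    have hcos := h0.cos
    have h := (h0.fun_add (((hsin.fun_mul hcos).const_mul (C - S)).fun_div
      (((hcos.fun_pow 2).const_mul S).fun_add ((hsin.fun_pow 2).const_mul C))
      (hD (a * s)).ne').arctan).div_const S
    refine h.congr_deriv ?_
    have hd := hD (a * s)
    have hsc := Real.sin_sq_add_cos_sq (a * s)
    generalize Real.sin (a * s) = p at *
    generalize Real.cos (a * s) = q at *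
    have hp : 0 < p ^ 2 + S ^ 2 := by positivity
    have hE : (S * q ^ 2 + C * p ^ 2) ^ 2 + ((C - S) * (p * q)) ^ 2 = p ^ 2 + S ^ 2 := by
      linear_combination (S ^ 2 * q ^ 2 + C ^ 2 * p ^ 2 + S ^ 2) * hsc + p ^ 2 * hCS
    have h1 : 1 + ((C - S) * (p * q) / (S * q ^ 2 + C * p ^ 2)) ^ 2 =
        (p ^ 2 + S ^ 2) / (S * q ^ 2 + C * p ^ 2) ^ 2 := by
      rw [← hE]
      field_simp
    rw [h1, one_div_div, div_mul_div_cancel₀' (by positivity)]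
    field_simp
    simp only [Nat.cast_ofNat, Nat.add_one_sub_one, pow_one]
    linear_combination ((C - S) * (S * q ^ 2 - C * p ^ 2) + C * S - S ^ 2) * hsc - p ^ 2 * hCS
  rw [integral_eq_sub_of_hasDerivAt (fun s _ => hder s)]
  · have : a * (π / a) = π := by field_simp
    simp [this]
  · refine Continuous.intervalIntegrable ?_ _ _
    refine Continuous.div (by fun_prop) (by fun_prop) fun s => ?_
    positivity

theorem sin_pos_of_mem_gap {a s : ℝ} (ha : 0 < a) (h0 : 0 < s) (h1 : s < π / a) :
    0 < Real.sin (a * s) := by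
  refine Real.sin_pos_of_pos_of_lt_pi (by positivity) ?_
  rwa [lt_div_iff₀ ha, mul_comm] at h1

theorem integral_gap_eq {a x : ℝ} (ha : 0 < a) (ε : ℝ) (k : ℕ) :
    ∫ t in (k * (π / a) + ε)..((k + 1) * (π / a) - ε), t / (Real.sin (a * t) * (x ^ 2 + t ^ 2)) =
      ∫ s in ε..(π / a - ε), (-1) ^ k * ((s + k * (π / a)) / (x ^ 2 + (s + k * (π / a)) ^ 2)) /
        Real.sin (a * s) := by
  rw [show (k * (π / a) + ε) = ε + k * (π / a) by ring,
    show ((k + 1) * (π / a) - ε) = (π / a - ε) + k * (π / a) by ring,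
    ← intervalIntegral.integral_comp_add_right]
  congr 1
  ext s
  have : a * (s + k * (π / a)) = a * s + k * π := by field_simp
  rw [this, Real.sin_add_nat_mul_pi]
  generalize x ^ 2 + (s + k * (π / a)) ^ 2 = A
  rcases Nat.even_or_odd k with h | h <;> simp only [h.neg_one_pow] <;> ring

theorem integral_gap_reflect {a x : ℝ} (ha : 0 < a) (ε : ℝ) (k : ℕ) :
    ∫ s in ε..(π / a - ε), (-1) ^ k * ((s + k * (π / a)) / (x ^ 2 + (s + k * (π / a)) ^ 2)) /
        Real.sin (a * s) =
      ∫ s in ε..(π / a - ε), (-1) ^ (k + 1) *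
        ((s - (k + 1) * (π / a)) / (x ^ 2 + (s - (k + 1) * (π / a)) ^ 2)) / Real.sin (a * s) := by
  have h := intervalIntegral.integral_comp_sub_left (a := ε) (b := π / a - ε) (fun s => (-1) ^ k *
    ((s + k * (π / a)) / (x ^ 2 + (s + k * (π / a)) ^ 2)) / Real.sin (a * s)) (π / a)
  rw [sub_sub_cancel] at h
  rw [← h]
  congr 1
  ext s
  have e1 : a * (π / a - s) = π - a * s := by field_simp
  have e2 : π / a - s + k * (π / a) = -(s - (k + 1) * (π / a)) := by ring
  rw [e1, Real.sin_pi_sub, e2, neg_sq, pow_succ]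
  ring

theorem continuousOn_gap_integrand {a x ε : ℝ} (ha : 0 < a) (hx : 0 < x) (hε : 0 < ε)
    (hε' : ε ≤ π / a - ε) (d : ℝ) (r : ℝ) :
    ContinuousOn (fun s => r * ((s + d) / (x ^ 2 + (s + d) ^ 2)) / Real.sin (a * s))
      (Set.uIcc ε (π / a - ε)) := by
  rw [Set.uIcc_of_le hε']
  refine ContinuousOn.div (Continuous.continuousOn ?_) (by fun_prop) fun s hs =>
    (sin_pos_of_mem_gap ha (hε.trans_le hs.1) (by linarith [hs.2])).ne'
  refine continuous_const.mul (Continuous.div (by fun_prop) (by fun_prop) fun s => ?_)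
  positivity

theorem tendsto_sum_integral_gap {a x ε : ℝ} (ha : 0 < a) (hx : 0 < x) (hε : 0 < ε)
    (hε' : ε ≤ π / a - ε) :
    Tendsto (fun N : ℕ => ∑ k ∈ Finset.range (N + 1),
      ∫ s in ε..(π / a - ε), (-1) ^ k * ((s + k * (π / a)) / (x ^ 2 + (s + k * (π / a)) ^ 2)) /
        Real.sin (a * s)) atTop
      (nhds (1 / 2 * ∫ s in ε..(π / a - ε),
        a * Real.cosh (a * x) / (Real.sin (a * s) ^ 2 + Real.sinh (a * x) ^ 2))) := by
  have hc : 0 < π / a := by positivity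
  have hac : π / (π / a) = a := by field_simp
  set c := π / a with hcdef
  set J : ℕ → ℝ := fun k => ∫ s in ε..(c - ε),
    (-1) ^ k * ((s + k * c) / (x ^ 2 + (s + k * c) ^ 2)) / Real.sin (a * s) with hJ
  set T : ℝ := ∫ s in ε..(c - ε),
    a * Real.cosh (a * x) / (Real.sin (a * s) ^ 2 + Real.sinh (a * x) ^ 2) with hT
  have hmem : ∀ s ∈ Set.uIoc ε (c - ε), 0 < s ∧ s < c := by
    intro s hs
    rw [Set.uIoc_of_le hε'] at hs
    exact ⟨hε.trans hs.1, by linarith [hs.2]⟩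
  have hsin : ∀ s ∈ Set.uIoc ε (c - ε), 0 < Real.sin (a * s) := fun s hs =>
    sin_pos_of_mem_gap ha (hmem s hs).1 (hmem s hs).2
  obtain ⟨M, hM⟩ : ∃ M, ∀ s ∈ Set.uIoc ε (c - ε), |1 / Real.sin (a * s)| ≤ M := by
    have hcont : ContinuousOn (fun s => 1 / Real.sin (a * s)) (Set.uIcc ε (c - ε)) := by
      rw [Set.uIcc_of_le hε']
      exact ContinuousOn.div (by fun_prop) (by fun_prop) fun s hs =>
        (sin_pos_of_mem_gap ha (hε.trans_le hs.1) (by linarith [hs.2])).ne'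
    obtain ⟨M, hM⟩ := isCompact_uIcc.exists_bound_of_continuousOn hcont
    exact ⟨M, fun s hs => hM s (Set.uIoc_subset_uIcc hs)⟩
  have hcont0 := fun (d r : ℝ) => continuousOn_gap_integrand ha hx hε hε' d r
  have hpair : ∀ n : ℕ, J n + J (n + 1) = ∫ s in ε..(c - ε), (-1) ^ (n + 1) *
      ((s + (n + 1) * c) / (x ^ 2 + (s + (n + 1) * c) ^ 2) +
        (s - (n + 1) * c) / (x ^ 2 + (s - (n + 1) * c) ^ 2)) / Real.sin (a * s) := by
    intro n
    have h1 := (hcont0 (-((n + 1) * c)) ((-1) ^ (n + 1))).intervalIntegrable (μ := volume)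
    have h2 := (hcont0 ((n + 1) * c) ((-1) ^ (n + 1))).intervalIntegrable (μ := volume)
    simp only [← sub_eq_add_neg] at h1
    simp only [hJ]
    rw [integral_gap_reflect ha, add_comm]
    push_cast
    rw [← intervalIntegral.integral_add h2 h1]
    congr 1
    ext s
    ring
  have hsum : HasSum (fun n => J n + J (n + 1)) (T - J 0) := by
    simp_rw [hpair]
    have hTJ : T - J 0 = ∫ s in ε..(c - ε), (a * Real.sin (a * s) * Real.cosh (a * x) /
        (Real.sin (a * s) ^ 2 + Real.sinh (a * x) ^ 2) - s / (x ^ 2 + s ^ 2)) /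
          Real.sin (a * s) := by
      have h0 := (hcont0 0 1).intervalIntegrable (μ := volume)
      simp only [hT, hJ]
      have e : ∀ s : ℝ, (-1) ^ 0 * ((s + (0 : ℕ) * c) / (x ^ 2 + (s + (0 : ℕ) * c) ^ 2)) /
          Real.sin (a * s) = 1 * ((s + 0) / (x ^ 2 + (s + 0) ^ 2)) / Real.sin (a * s) := by
        intro s; simp
      simp_rw [e]
      rw [← intervalIntegral.integral_sub _ h0]
      · refine intervalIntegral.integral_congr_ae (Eventually.of_forall fun s hs => ?_)
        have h1 := hsin s hs
        have h2 : Real.sin (a * s) ^ 2 + Real.sinh (a * x) ^ 2 ≠ 0 := by positivity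
        simp only [add_zero, one_mul]
        rw [sub_div]
        congr 1
        field_simp
      · refine Continuous.intervalIntegrable ?_ _ _
        have hS : 0 < Real.sinh (a * x) := Real.sinh_pos_iff.2 (mul_pos ha hx)
        refine Continuous.div (by fun_prop) (by fun_prop) fun s => ?_
        positivity
    rw [hTJ]
    refine intervalIntegral.hasSum_integral_of_dominated_convergence
      (fun n _ => 2 * c / (x ^ 2 + (n * c) ^ 2) * M) (fun n => ?_) (fun n => ?_) ?_ ?_ ?_
    · exact Measurable.aestronglyMeasurable (by fun_prop)
    · refine Eventually.of_forall fun s hs => ?_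
      rw [Real.norm_eq_abs, div_eq_mul_one_div, abs_mul, abs_mul, abs_pow, abs_neg, abs_one,
        one_pow, one_mul]
      gcongr
      · exact abs_kernel_pair_le hc hx ⟨(hmem s hs).1.le, (hmem s hs).2.le⟩ n
      · exact hM s hs
    · exact Eventually.of_forall fun s _ => (summable_kernel_bound hc).mul_right M
    · exact intervalIntegrable_const
    · refine Eventually.of_forall fun s _ => ?_
      have h := hasSum_alternating_kernel (s := s) hc hx
      rw [hac] at h
      exact h.div_const _
  have hJ0 : Tendsto J atTop (nhds 0) := by
    have hlim : Tendsto (fun n : ℕ => 1 / (n * c) * M * |c - ε - ε|) atTop (nhds 0) := by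
      have : Tendsto (fun n : ℕ => 1 / (n * c)) atTop (nhds 0) := by
        simp_rw [one_div]
        exact (tendsto_natCast_atTop_atTop.atTop_mul_const hc).inv_tendsto_atTop
      simpa using (this.mul_const M).mul_const |c - ε - ε|
    refine squeeze_zero_norm' ?_ hlim
    filter_upwards [eventually_gt_atTop 0] with n hn
    have hn' : (0 : ℝ) < n := by exact_mod_cast hn
    refine intervalIntegral.norm_integral_le_of_norm_le_const fun s hs => ?_
    have h0 := (hmem s hs).1
    rw [Real.norm_eq_abs, div_eq_mul_one_div, abs_mul, abs_mul, abs_pow, abs_neg, abs_one,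
        one_pow, one_mul]
    gcongr
    · refine (abs_div_sq_add_sq_le (by positivity)).trans ?_
      gcongr
      linarith
    · exact hM s hs
  have hfin : ∀ N : ℕ, ∑ k ∈ Finset.range (N + 1), J k =
      1 / 2 * (∑ k ∈ Finset.range N, (J k + J (k + 1)) + J 0 + J N) := by
    intro N
    rw [Finset.sum_add_distrib, add_assoc (∑ k ∈ Finset.range N, J k),
      ← Finset.sum_range_succ' J N, add_right_comm, ← Finset.sum_range_succ J N]
    ring
  simp_rw [hfin]
  have h := ((hsum.tendsto_sum_nat.add_const (J 0)).add hJ0).const_mul (1 / 2)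
  simpa using h

theorem tendsto_integral_shrinking {K : ℝ → ℝ} (hK : Continuous K) (c : ℝ) :
    Tendsto (fun ε => ∫ s in ε..(c - ε), K s) (nhdsWithin 0 (Set.Ioi 0))
      (nhds (∫ s in (0 : ℝ)..c, K s)) := by
  have hP : Continuous fun t => ∫ s in (0 : ℝ)..t, K s :=
    intervalIntegral.continuous_primitive (fun _ _ => hK.intervalIntegrable _ _) 0
  have hcont : Continuous fun ε => (∫ s in (0 : ℝ)..(c - ε), K s) - ∫ s in (0 : ℝ)..ε, K s :=
    (hP.comp (continuous_const.sub continuous_id)).sub hP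
  have h := (hcont.tendsto 0).mono_left (nhdsWithin_le_nhds (s := Set.Ioi 0))
  simp only [sub_zero, intervalIntegral.integral_same] at h
  refine h.congr fun ε => ?_
  rw [intervalIntegral.integral_interval_sub_left] <;> exact hK.intervalIntegrable _ _

theorem intervalIntegrable_first_gap {a x b : ℝ} (ha : 0 < a) (hx : 0 < x) (hb : 0 ≤ b)
    (hb' : b < π / a) :
    IntervalIntegrable (fun t => t / (Real.sin (a * t) * (x ^ 2 + t ^ 2))) volume 0 b := by
  have hcont : ContinuousOn (fun t => 1 / (a * Real.sinc (a * t) * (x ^ 2 + t ^ 2)))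
      (Set.uIcc 0 b) := by
    refine ContinuousOn.div (by fun_prop) (Continuous.continuousOn (by fun_prop)) fun t ht => ?_
    rw [Set.uIcc_of_le hb] at ht
    have : 0 < Real.sinc (a * t) := by
      rcases ht.1.eq_or_lt with h | h
      · simp [← h]
      · rw [Real.sinc_of_ne_zero (by positivity)]
        exact div_pos (sin_pos_of_mem_gap ha h (ht.2.trans_lt hb')) (by positivity)
    positivity
  refine (intervalIntegrable_congr fun t ht => ?_).1 hcont.intervalIntegrable
  rw [Set.uIoc_of_le hb] at ht
  have h0 := ht.1
  have h1 := sin_pos_of_mem_gap ha h0 (ht.2.trans_lt hb')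
  rw [Real.sinc_of_ne_zero (by positivity)]
  field_simp

theorem tendsto_integral_first_gap {a x : ℝ} (ha : 0 < a) (hx : 0 < x) :
    Tendsto (fun ε => ∫ t in (0 : ℝ)..ε, t / (Real.sin (a * t) * (x ^ 2 + t ^ 2)))
      (nhdsWithin 0 (Set.Ioi 0)) (nhds 0) := by
  have hc : 0 < π / a := by positivity
  have hb : (0 : ℝ) < π / a / 2 := by positivity
  have hint := intervalIntegrable_first_gap (x := x) ha hx hb.le (by linarith)
  have h := intervalIntegral.continuousOn_primitive_interval
    (by rw [Set.uIcc_of_le hb.le]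
        exact (intervalIntegrable_iff_integrableOn_Icc_of_le hb.le).1 hint)
  have h0 := (h 0 Set.left_mem_uIcc).tendsto
  simp only [intervalIntegral.integral_same] at h0
  refine h0.mono_left ?_
  rw [Set.uIcc_of_le hb.le]
  exact nhdsWithin_le_of_mem (Icc_mem_nhdsGT hb)

theorem pv_t_over_sin (a x : ℝ) (ha : 0 < a) (hx : 0 < x) :
    IsPVIntegral (fun t => t / (Real.sin (a * t) * (x ^ 2 + t ^ 2))) (fun k => ((k : ℝ) + 1) * Real.pi / a) (Real.pi / (2 * Real.sinh (a * x))) := by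
  have hc : 0 < π / a := by positivity
  refine ⟨π / a / 2, by positivity, fun ε =>
    (∫ t in (0 : ℝ)..ε, t / (Real.sin (a * t) * (x ^ 2 + t ^ 2))) +
      1 / 2 * ∫ s in ε..(π / a - ε),
        a * Real.cosh (a * x) / (Real.sin (a * s) ^ 2 + Real.sinh (a * x) ^ 2), ?_, ?_⟩
  · rintro ε ⟨hε, hε2⟩
    have hε' : ε ≤ π / a - ε := by linarith
    refine ((tendsto_sum_integral_gap ha hx hε hε').const_add
      (∫ t in (0 : ℝ)..ε, t / (Real.sin (a * t) * (x ^ 2 + t ^ 2)))).congr fun N => ?_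
    have hi := intervalIntegrable_first_gap (x := x) ha hx (b := π / a - ε) (by linarith)
      (by linarith)
    have hi' := intervalIntegrable_first_gap (x := x) ha hx hε.le (by linarith)
    rw [Finset.sum_range_succ', add_comm (∑ k ∈ Finset.range N, _), ← add_assoc,
      ← integral_gap_eq ha]
    congr 1
    · have := intervalIntegral.integral_add_adjacent_intervals hi' (hi'.symm.trans hi)
      simpa using this
    · refine Finset.sum_congr rfl fun k _ => ?_
      rw [← integral_gap_eq ha]
      push_cast
      simp only [mul_div_assoc]
  · have hS : 0 < Real.sinh (a * x) := Real.sinh_pos_iff.2 (mul_pos ha hx)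
    have hK : Continuous fun s =>
        a * Real.cosh (a * x) / (Real.sin (a * s) ^ 2 + Real.sinh (a * x) ^ 2) :=
      Continuous.div (by fun_prop) (by fun_prop) fun s => by positivity
    have h := (tendsto_integral_first_gap ha hx).add
      ((tendsto_integral_shrinking hK (π / a)).const_mul (1 / 2))
    rw [integral_cosh_div ha hx] at h
    convert h using 2
    field_simp
    ring
end

section
/- For all x > 0 and 0 < a < b, the principal value integral over t in (0, ∞) of t·sin(a t) / (cos(b t) · (x² + t²)) dt equals −(π/2) · sinh(a x) / cosh(b x). -/
open Real MeasureTheory Filter intervalIntegral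

/-- The general term `(-1)ⁿ e^{iπcn} / (w + nπ)` of the twisted cosecant expansion. -/
noncomputable def twistedCscTerm (c : ℝ) (w : ℂ) (n : ℤ) : ℂ :=
  (-1) ^ n * Complex.exp (π * Complex.I * c * n) / (w + n * π)

theorem sq_add_sq_le_sq_norm_add_int_mul_pi {w : ℂ} (hw : |w.re| ≤ π / 2) (n : ℤ) :
    (n : ℝ) ^ 2 + w.im ^ 2 ≤ ‖w + n * π‖ ^ 2 := by
  have h : (n : ℝ) ^ 2 ≤ (w.re + n * π) ^ 2 := by
    rw [sq_le_sq]
    rcases eq_or_ne n 0 with rfl | hn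
    · simp
    have h1 : (1 : ℝ) ≤ |(n : ℝ)| := by exact_mod_cast Int.one_le_abs hn
    have h2 : |(n : ℝ) * π| ≤ |w.re + n * π| + |w.re| := by
      simpa using abs_sub (w.re + n * π) w.re
    rw [abs_mul, abs_of_pos pi_pos] at h2
    nlinarith [pi_gt_three]
  rw [← Complex.normSq_eq_norm_sq, Complex.normSq_apply]
  simp only [Complex.add_re, Complex.mul_re, Complex.intCast_re, Complex.ofReal_re,
    Complex.intCast_im, Complex.ofReal_im, Complex.add_im, Complex.mul_im]
  nlinarith

theorem summable_one_div_int_sq_add_sq (y : ℝ) :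
    Summable fun n : ℤ => 1 / ((n : ℝ) ^ 2 + y ^ 2) := by
  refine Summable.of_norm_bounded_eventually
    (Real.summable_one_div_int_pow.mpr (one_lt_two : 1 < 2)) ?_
  filter_upwards [(Set.finite_singleton (0 : ℤ)).compl_mem_cofinite] with n hn
  have hn' : (n : ℝ) ≠ 0 := by exact_mod_cast hn
  have h : 0 < (n : ℝ) ^ 2 := by positivity
  rw [Real.norm_of_nonneg (by positivity)]
  exact one_div_le_one_div_of_le h (by nlinarith [sq_nonneg y])

/-- A summable bound for the telescoped terms of the twisted cosecant expansion. -/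
noncomputable def twistedCscBound (y : ℝ) (n : ℤ) : ℝ :=
  π / 2 * (1 / ((n : ℝ) ^ 2 + y ^ 2) + 1 / (((n - 1 : ℤ) : ℝ) ^ 2 + y ^ 2))

theorem summable_twistedCscBound (y : ℝ) : Summable (twistedCscBound y) :=
  ((summable_one_div_int_sq_add_sq y).add
    ((summable_one_div_int_sq_add_sq y).comp_injective (sub_left_injective (b := 1)))).mul_left _

theorem add_int_mul_pi_ne_zero {w : ℂ} (hw : w.im ≠ 0) (n : ℤ) : w + n * π ≠ 0 := by
  intro h
  apply hw
  simpa using congrArg Complex.im h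

theorem twistedCscTerm_add (c : ℝ) (w : ℂ) (n : ℤ) :
    twistedCscTerm c w n + Complex.exp (π * Complex.I * c) * twistedCscTerm c w (n - 1) =
      (-1) ^ n * Complex.exp (π * Complex.I * c * n) *
        (1 / (w + n * π) - 1 / (w + (n - 1 : ℤ) * π)) := by
  have h : Complex.exp (π * Complex.I * c * n) =
      Complex.exp (π * Complex.I * c) * Complex.exp (π * Complex.I * c * (n - 1 : ℤ)) := by
    rw [← Complex.exp_add]
    push_cast
    ring_nf
  unfold twistedCscTerm
  rw [h, zpow_sub_one₀ (by norm_num)]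
  ring

theorem norm_neg_one_zpow_mul_exp (c : ℝ) (n : ℤ) :
    ‖(-1 : ℂ) ^ n * Complex.exp (π * Complex.I * c * n)‖ = 1 := by
  rw [norm_mul, norm_zpow, norm_neg, norm_one, one_zpow, one_mul,
    show (π * Complex.I * c * n : ℂ) = ((π * c * n : ℝ) : ℂ) * Complex.I by push_cast; ring,
    Complex.norm_exp_ofReal_mul_I]

theorem norm_one_div_sub_le {w : ℂ} (hw : |w.re| ≤ π / 2) (hi : w.im ≠ 0) (n : ℤ) :
    ‖1 / (w + n * π) - 1 / (w + (n - 1 : ℤ) * π)‖ ≤ twistedCscBound w.im n := by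
  have h1 := add_int_mul_pi_ne_zero hi n
  have h2 := add_int_mul_pi_ne_zero hi (n - 1)
  have e : 1 / (w + n * π) - 1 / (w + (n - 1 : ℤ) * π) =
      -π * (1 / (w + n * π)) * (1 / (w + (n - 1 : ℤ) * π)) := by
    rw [div_sub_div _ _ h1 h2, mul_assoc, one_div_mul_one_div, mul_one_div]
    push_cast
    ring
  have key (m : ℤ) : ‖1 / (w + m * π)‖ ^ 2 ≤ 1 / ((m : ℝ) ^ 2 + w.im ^ 2) := by
    rw [norm_div, norm_one, div_pow, one_pow]
    exact one_div_le_one_div_of_le (by positivity) (sq_add_sq_le_sq_norm_add_int_mul_pi hw m)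
  rw [e, norm_mul, norm_mul, norm_neg, Complex.norm_real, Real.norm_of_nonneg pi_pos.le,
    twistedCscBound]
  have k1 := key n
  have k2 := key (n - 1)
  set A := ‖1 / (w + n * π)‖
  set B := ‖1 / (w + (n - 1 : ℤ) * π)‖
  nlinarith [pi_pos, sq_nonneg (A - B)]

theorem tendsto_twistedCscTerm (c : ℝ) {w : ℂ} (hw : |w.re| ≤ π / 2) (hi : w.im ≠ 0) :
    Tendsto (twistedCscTerm c w) cofinite (nhds 0) := by
  have h : Tendsto (fun n => ‖twistedCscTerm c w n‖ ^ 2) cofinite (nhds 0) := by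
    refine squeeze_zero (fun _ => by positivity) (fun n => ?_)
      (summable_one_div_int_sq_add_sq w.im).tendsto_cofinite_zero
    rw [twistedCscTerm, norm_div, norm_neg_one_zpow_mul_exp, div_pow, one_pow]
    exact one_div_le_one_div_of_le (by positivity) (sq_add_sq_le_sq_norm_add_int_mul_pi hw n)
  simpa [tendsto_zero_iff_norm_tendsto_zero] using h.sqrt

theorem norm_twistedCscTerm_le (c : ℝ) {w : ℂ} (hi : w.im ≠ 0) (n : ℤ) :
    ‖twistedCscTerm c w n‖ ≤ 1 / |w.im| := by
  rw [twistedCscTerm, norm_div, norm_neg_one_zpow_mul_exp]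
  refine one_div_le_one_div_of_le (abs_pos.mpr hi) ?_
  simpa using Complex.abs_im_le_norm (w + n * π)

theorem integral_exp_neg_mul_I {y : ℂ} (hy : y ≠ 0) :
    ∫ s in (-1 : ℝ)..1, Complex.exp (-(y * Complex.I) * s) = 2 * Complex.sin y / y := by
  rw [integral_exp_mul_complex (by simpa using hy), Complex.sin]
  field_simp
  push_cast
  ring_nf
  rw [Complex.I_sq]
  ring

theorem Complex.sin_add_int_mul_pi (w : ℂ) (n : ℤ) :
    Complex.sin (w + n * π) = (-1) ^ n * Complex.sin w :=
  n.cast_negOnePow ℂ ▸ Complex.sin_antiperiodic.add_int_mul_eq n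

theorem hasSum_twistedCsc {c : ℝ} (hc : c ∈ Set.Ioo (-1 : ℝ) 1) {w : ℂ} (hw : |w.re| ≤ π / 2)
    (hi : w.im ≠ 0) (hs : Complex.sin w ≠ 0) :
    HasSum (fun n : ℤ => twistedCscTerm c w n +
        Complex.exp (π * Complex.I * c) * twistedCscTerm c w (n - 1))
      ((1 + Complex.exp (π * Complex.I * c)) *
        (Complex.exp (-(w * Complex.I) * c) / Complex.sin w)) := by
  have : Fact (0 < (2 : ℝ)) := ⟨two_pos⟩
  set φ : ℝ → ℂ := fun s =>
    (1 + Complex.exp (π * Complex.I * s)) * Complex.exp (-(w * Complex.I) * s) with hφ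
  have hend : φ (-1) = φ (-1 + 2) := by
    have h1 : Complex.exp (-(π * Complex.I)) = -1 := by 
      rw [Complex.exp_neg, Complex.exp_pi_mul_I]; norm_num
    norm_num [hφ, h1]
  have hcont : Continuous φ := by fun_prop
  let f : C(AddCircle (2 : ℝ), ℂ) :=
    ⟨AddCircle.liftIoc 2 (-1) φ, AddCircle.liftIoc_continuous hend hcont.continuousOn⟩
  have hcoeff (n : ℤ) : fourierCoeff f n =
      Complex.sin w * ((-1) ^ n * (1 / (w + n * π) - 1 / (w + (n - 1 : ℤ) * π))) := by
    have h1 := add_int_mul_pi_ne_zero hi n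
    have h2 := add_int_mul_pi_ne_zero hi (n - 1)
    have e : ∀ s : ℝ, fourier (-n) (s : AddCircle (2 : ℝ)) • φ s =
        Complex.exp (-((w + n * π) * Complex.I) * s) +
          Complex.exp (-((w + (n - 1 : ℤ) * π) * Complex.I) * s) := by
      intro s
      rw [fourier_coe_apply, hφ, smul_eq_mul]
      simp only [add_mul, one_mul, mul_add, ← Complex.exp_add]
      congr 2 <;> push_cast <;> ring
    change fourierCoeff (AddCircle.liftIoc 2 (-1) φ) n = _
    rw [fourierCoeff_liftIoc_eq, fourierCoeffOn_eq_integral]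
    have hT : (-1 + 2 - -1 : ℝ) = 2 := by norm_num
    have hU : (-1 + 2 : ℝ) = 1 := by norm_num
    rw [hT, hU]
    simp_rw [e]
    rw [intervalIntegral.integral_add (Continuous.intervalIntegrable (by fun_prop) _ _)
      (Continuous.intervalIntegrable (by fun_prop) _ _), integral_exp_neg_mul_I h1,
      integral_exp_neg_mul_I h2, Complex.sin_add_int_mul_pi, Complex.sin_add_int_mul_pi,
      zpow_sub_one₀ (by norm_num)]
    rw [Complex.real_smul]
    push_cast
    ring
  have hsum : Summable (fourierCoeff f) := by
    simp_rw [funext hcoeff]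
    refine Summable.mul_left _ (Summable.of_norm_bounded (summable_twistedCscBound w.im) ?_)
    intro n
    rw [norm_mul, norm_zpow, norm_neg, norm_one, one_zpow, one_mul]
    exact norm_one_div_sub_le hw hi n
  have hS := (has_pointwise_sum_fourier_series_of_summable hsum (c : AddCircle (2 : ℝ))).mul_left
    (Complex.sin w)⁻¹
  have hval : f (c : AddCircle (2 : ℝ)) = φ c := by
    have hc' : c ∈ Set.Ioc (-1 : ℝ) (-1 + 2) := ⟨hc.1, by linarith [hc.2]⟩
    change AddCircle.liftIoc 2 (-1) φ c = φ c
    exact AddCircle.liftIoc_coe_apply hc'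
  rw [hval] at hS
  convert! hS using 1
  · ext n
    rw [twistedCscTerm_add c w, hcoeff, fourier_coe_apply, smul_eq_mul]
    have e : (2 * π * Complex.I * n * c / (2 : ℝ) : ℂ) = π * Complex.I * c * n := by
      push_cast; ring
    rw [e]
    field_simp
  · simp only [hφ]
    field_simp

theorem sum_Icc_twistedCscTerm (c : ℝ) (w : ℂ) (N : ℕ) :
    (1 + Complex.exp (π * Complex.I * c)) *
        ∑ n ∈ Finset.Icc (-(N : ℤ)) N, twistedCscTerm c w n =
      ∑ n ∈ Finset.Icc (-(N : ℤ)) N, (twistedCscTerm c w n +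
          Complex.exp (π * Complex.I * c) * twistedCscTerm c w (n - 1)) +
        Complex.exp (π * Complex.I * c) *
          (twistedCscTerm c w N - twistedCscTerm c w (-(N : ℤ) - 1)) := by
  induction N with
  | zero => simp; ring
  | succ N ih =>
    push_cast
    rw [Finset.sum_Icc_succ_eq_add_endpoints, Finset.sum_Icc_succ_eq_add_endpoints, mul_add,
      mul_add, ih]
    have e1 : -((N : ℤ) + 1) = -N - 1 := by ring
    have e2 : (N : ℤ) + 1 - 1 = N := by ring
    rw [e1, e2]
    ring

theorem one_add_exp_pi_mul_I_ne_zero {c : ℝ} (hc : c ∈ Set.Ioo (-1 : ℝ) 1) :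
    1 + Complex.exp (π * Complex.I * c) ≠ 0 := by
  intro h
  have h1 : (π * Complex.I * c : ℂ) = ((π * c : ℝ) : ℂ) * Complex.I := by push_cast; ring
  have h2 := congrArg Complex.re h
  rw [h1, Complex.add_re, Complex.exp_ofReal_mul_I_re, Complex.one_re, Complex.zero_re] at h2
  have h3 := congrArg Complex.im h
  rw [h1, Complex.add_im, Complex.exp_ofReal_mul_I_im, Complex.one_im, Complex.zero_im,
    zero_add] at h3
  have h4 : π * c = 0 := by
    refine (Real.sin_eq_zero_iff_of_lt_of_lt ?_ ?_).mp h3 <;> nlinarith [hc.1, hc.2, pi_pos]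
  rw [h4, Real.cos_zero] at h2
  norm_num at h2

theorem tendsto_sum_Icc_twistedCscTerm {c : ℝ} (hc : c ∈ Set.Ioo (-1 : ℝ) 1) {w : ℂ}
    (hw : |w.re| ≤ π / 2) (hi : w.im ≠ 0) (hs : Complex.sin w ≠ 0) :
    Tendsto (fun N : ℕ => ∑ n ∈ Finset.Icc (-(N : ℤ)) N, twistedCscTerm c w n) atTop
      (nhds (Complex.exp (-(w * Complex.I) * c) / Complex.sin w)) := by
  have hz := one_add_exp_pi_mul_I_ne_zero hc
  have hcof := tendsto_twistedCscTerm c hw hi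
  have hN : Tendsto (fun N : ℕ => twistedCscTerm c w N) atTop (nhds 0) :=
    hcof.comp (Nat.cofinite_eq_atTop ▸ Nat.cast_injective.tendsto_cofinite)
  have hN' : Tendsto (fun N : ℕ => twistedCscTerm c w (-(N : ℤ) - 1)) atTop (nhds 0) := by
    refine hcof.comp (Nat.cofinite_eq_atTop ▸ Function.Injective.tendsto_cofinite ?_)
    intro m n h
    simpa using h
  have h := ((hasSum_twistedCsc hc hw hi hs).comp Finset.tendsto_Icc_neg).add
    ((hN.sub hN').const_mul (Complex.exp (π * Complex.I * c)))
  simp only [Function.comp_def, sub_zero, mul_zero, add_zero] at h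
  have h' := h.congr fun N => (sum_Icc_twistedCscTerm c w N).symm
  simpa [hz] using h'.const_mul (1 + Complex.exp (π * Complex.I * c))⁻¹

theorem norm_sum_Icc_twistedCscTerm_le {c : ℝ} (hc : c ∈ Set.Ioo (-1 : ℝ) 1) {w : ℂ}
    (hw : |w.re| ≤ π / 2) (hi : w.im ≠ 0) (N : ℕ) :
    ‖∑ n ∈ Finset.Icc (-(N : ℤ)) N, twistedCscTerm c w n‖ ≤
      (∑' n, twistedCscBound w.im n + 2 / |w.im|) / ‖1 + Complex.exp (π * Complex.I * c)‖ := by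
  have hz := one_add_exp_pi_mul_I_ne_zero hc
  have hexp : ‖Complex.exp (π * Complex.I * c)‖ = 1 := by
    simpa using norm_neg_one_zpow_mul_exp c 1
  rw [le_div_iff₀ (norm_pos_iff.mpr hz), mul_comm, ← norm_mul, sum_Icc_twistedCscTerm]
  refine (norm_add_le _ _).trans (add_le_add ?_ ?_)
  · refine (norm_sum_le_of_le _ fun n _ => ?_).trans
      ((summable_twistedCscBound w.im).sum_le_tsum _ fun n _ => ?_)
    · rw [twistedCscTerm_add c w, norm_mul, norm_neg_one_zpow_mul_exp, one_mul]
      exact norm_one_div_sub_le hw hi n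
    · exact (norm_nonneg _).trans (norm_one_div_sub_le hw hi n)
  · rw [norm_mul, hexp, one_mul]
    refine (norm_sub_le _ _).trans ?_
    have h1 := norm_twistedCscTerm_le c hi N
    have h2 := norm_twistedCscTerm_le c hi (-(N : ℤ) - 1)
    rw [show 2 / |w.im| = 1 / |w.im| + 1 / |w.im| by ring]
    exact add_le_add h1 h2

theorem neg_one_zpow_mul_sin_div_eq_im (c v : ℝ) {y : ℝ} (hy : y ≠ 0) (n : ℤ) :
    (-1) ^ n * ((v + n * π) * Real.sin (c * (v + n * π)) / (y ^ 2 + (v + n * π) ^ 2)) =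
      (Complex.exp (c * v * Complex.I) / 2 * (twistedCscTerm c (v - y * Complex.I) n +
        twistedCscTerm c (v + y * Complex.I) n)).im := by
  have h1 : (v - y * Complex.I + n * π : ℂ) ≠ 0 := add_int_mul_pi_ne_zero (by simpa) n
  have h2 : (v + y * Complex.I + n * π : ℂ) ≠ 0 := add_int_mul_pi_ne_zero (by simpa) n
  have h3 : (y ^ 2 + (v + n * π) ^ 2 : ℂ) =
      (v - y * Complex.I + n * π) * (v + y * Complex.I + n * π) := by
    linear_combination (y : ℂ) ^ 2 * Complex.I_sq
  have h4 : (1 / (v - y * Complex.I + n * π) + 1 / (v + y * Complex.I + n * π) : ℂ) =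
      2 * ((v + n * π) / (y ^ 2 + (v + n * π) ^ 2)) := by
    rw [h3, div_add_div _ _ h1 h2]
    ring
  have h5 : Complex.exp (c * v * Complex.I) * Complex.exp (π * Complex.I * c * n) =
      Complex.exp ((c * (v + n * π) : ℝ) * Complex.I) := by
    rw [← Complex.exp_add]
    push_cast
    ring_nf
  have h6 : Complex.exp (c * v * Complex.I) / 2 * (twistedCscTerm c (v - y * Complex.I) n +
        twistedCscTerm c (v + y * Complex.I) n) =
      (((-1) ^ n * ((v + n * π) / (y ^ 2 + (v + n * π) ^ 2)) : ℝ) : ℂ) *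
        Complex.exp ((c * (v + n * π) : ℝ) * Complex.I) := by
    rw [← h5]
    push_cast
    unfold twistedCscTerm
    linear_combination (Complex.exp (c * v * Complex.I) * Complex.exp (π * Complex.I * c * n) *
      (-1) ^ n / 2) * h4
  rw [h6, Complex.im_ofReal_mul, Complex.exp_ofReal_mul_I_im]
  ring

theorem Complex.sin_ofReal_add_mul_I (v y : ℝ) :
    Complex.sin (v + y * Complex.I) =
      ((Real.sin v * Real.cosh y : ℝ) : ℂ) + (Real.cos v * Real.sinh y : ℝ) * Complex.I := by
  rw [Complex.sin_add_mul_I]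
  push_cast
  ring

theorem sin_mul_cosh_sq_add_cos_mul_sinh_sq (v y : ℝ) :
    (Real.sin v * Real.cosh y) ^ 2 + (Real.cos v * Real.sinh y) ^ 2 =
      Real.sin v ^ 2 + Real.sinh y ^ 2 := by
  rw [mul_pow, mul_pow, Real.cosh_sq, Real.cos_sq']
  ring

theorem sin_sq_add_sinh_sq_pos (v : ℝ) {y : ℝ} (hy : y ≠ 0) :
    0 < Real.sin v ^ 2 + Real.sinh y ^ 2 := by
  have := Real.sinh_ne_zero.mpr hy
  positivity

theorem Complex.sin_ofReal_add_mul_I_ne_zero (v : ℝ) {y : ℝ} (hy : y ≠ 0) :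
    Complex.sin (v + y * Complex.I) ≠ 0 := by
  intro h
  rw [Complex.sin_ofReal_add_mul_I] at h
  have hr := congrArg Complex.re h
  have hi := congrArg Complex.im h
  simp only [Complex.add_re, Complex.ofReal_re, Complex.re_ofReal_mul, Complex.I_re, mul_zero,
    add_zero, Complex.zero_re, Complex.add_im, Complex.ofReal_im, Complex.im_ofReal_mul,
    Complex.I_im, mul_one, zero_add, Complex.zero_im] at hr hi
  have := sin_mul_cosh_sq_add_cos_mul_sinh_sq v y
  rw [hr, hi] at this
  linarith [sin_sq_add_sinh_sq_pos v hy]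

theorem im_real_div_sin (A v y : ℝ) :
    ((A : ℂ) / Complex.sin (v + y * Complex.I)).im =
      -(A * (Real.cos v * Real.sinh y)) / (Real.sin v ^ 2 + Real.sinh y ^ 2) := by
  rw [Complex.sin_ofReal_add_mul_I, Complex.div_im, ← sin_mul_cosh_sq_add_cos_mul_sinh_sq,
    Complex.normSq_add_mul_I]
  simp only [Complex.add_re, Complex.ofReal_re, Complex.re_ofReal_mul, Complex.I_re, mul_zero,
    add_zero, Complex.add_im, Complex.ofReal_im, Complex.im_ofReal_mul, Complex.I_im, mul_one,
    zero_add, zero_mul, zero_div]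
  ring

theorem tendsto_sum_neg_one_zpow_mul_sin_div {c : ℝ} (hc : c ∈ Set.Ioo (-1 : ℝ) 1) {v y : ℝ}
    (hv : |v| ≤ π / 2) (hy : y ≠ 0) :
    Tendsto (fun N : ℕ => ∑ n ∈ Finset.Icc (-(N : ℤ)) N,
        (-1) ^ n * ((v + n * π) * Real.sin (c * (v + n * π)) / (y ^ 2 + (v + n * π) ^ 2))) atTop
      (nhds (-(Real.sinh (c * y) * Real.sinh y * Real.cos v) /
        (Real.sin v ^ 2 + Real.sinh y ^ 2))) := by
  have hm : (v - y * Complex.I : ℂ) = v + ((-y : ℝ) : ℂ) * Complex.I := by push_cast; ring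
  have hneg : -y ≠ 0 := neg_ne_zero.mpr hy
  have h1 := tendsto_sum_Icc_twistedCscTerm hc (w := v - y * Complex.I) (by simpa) (by simpa)
    (hm ▸ Complex.sin_ofReal_add_mul_I_ne_zero v hneg)
  have h2 := tendsto_sum_Icc_twistedCscTerm hc (w := v + y * Complex.I) (by simpa) (by simpa)
    (Complex.sin_ofReal_add_mul_I_ne_zero v hy)
  have h3 := (Complex.continuous_im.tendsto _).comp
    ((h1.add h2).const_mul (Complex.exp (c * v * Complex.I) / 2))
  convert! h3 using 1
  · ext N
    simp only [Function.comp_def, ← Finset.sum_add_distrib, Finset.mul_sum, Complex.im_sum]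
    exact Finset.sum_congr rfl fun n _ => neg_one_zpow_mul_sin_div_eq_im c v hy n
  · have e1 : Complex.exp (c * v * Complex.I) *
        Complex.exp (-((v - y * Complex.I) * Complex.I) * c) = (Real.exp (-(c * y)) : ℝ) := by
      rw [← Complex.exp_add, Complex.ofReal_exp]
      congr 1
      push_cast
      linear_combination (y * c : ℂ) * Complex.I_sq
    have e2 : Complex.exp (c * v * Complex.I) *
        Complex.exp (-((v + y * Complex.I) * Complex.I) * c) = (Real.exp (c * y) : ℝ) := by
      rw [← Complex.exp_add, Complex.ofReal_exp]
      congr 1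
      push_cast
      linear_combination (-(y * c) : ℂ) * Complex.I_sq
    have e3 : Complex.exp (c * v * Complex.I) / 2 *
        (Complex.exp (-((v - y * Complex.I) * Complex.I) * c) / Complex.sin (v - y * Complex.I) +
          Complex.exp (-((v + y * Complex.I) * Complex.I) * c) /
            Complex.sin (v + y * Complex.I)) =
        ((1 / 2 : ℝ) : ℂ) * ((Real.exp (-(c * y)) : ℝ) / Complex.sin (v + (-y : ℝ) * Complex.I) +
          (Real.exp (c * y) : ℝ) / Complex.sin (v + y * Complex.I)) := by
      rw [← e1, ← e2, ← hm]
      push_cast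
      ring
    rw [e3, Complex.im_ofReal_mul, Complex.add_im, im_real_div_sin, im_real_div_sin,
      Real.sinh_neg, neg_sq, Real.sinh_eq (c * y)]
    ring_nf

theorem exists_abs_sum_neg_one_zpow_mul_sin_div_le {c : ℝ} (hc : c ∈ Set.Ioo (-1 : ℝ) 1) {y : ℝ}
    (hy : y ≠ 0) :
    ∃ K : ℝ, ∀ v : ℝ, |v| ≤ π / 2 → ∀ N : ℕ, |∑ n ∈ Finset.Icc (-(N : ℤ)) N,
      (-1) ^ n * ((v + n * π) * Real.sin (c * (v + n * π)) / (y ^ 2 + (v + n * π) ^ 2))| ≤ K := by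
  let B (u : ℝ) : ℝ :=
    (∑' n, twistedCscBound u n + 2 / |u|) / ‖1 + Complex.exp (π * Complex.I * c)‖
  refine ⟨1 / 2 * (B (-y) + B y), fun v hv N => ?_⟩
  have h1 := norm_sum_Icc_twistedCscTerm_le hc (w := v - y * Complex.I) (by simpa) (by simpa) N
  have h2 := norm_sum_Icc_twistedCscTerm_le hc (w := v + y * Complex.I) (by simpa) (by simpa) N
  have hre : ‖Complex.exp (c * v * Complex.I) / 2‖ = 1 / 2 := by
    rw [norm_div, ← Complex.ofReal_mul, Complex.norm_exp_ofReal_mul_I]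
    simp
  simp_rw [neg_one_zpow_mul_sin_div_eq_im c v hy, ← Complex.im_sum, ← Finset.mul_sum,
    Finset.sum_add_distrib]
  refine (Complex.abs_im_le_norm _).trans ?_
  rw [norm_mul, hre]
  refine mul_le_mul_of_nonneg_left ((norm_add_le _ _).trans (add_le_add ?_ ?_)) (by norm_num)
  · simpa [B] using h1
  · simpa [B] using h2

theorem cos_pos_of_abs_le_s15 {h v : ℝ} (hh : h < π / 2) (hv : |v| ≤ h) : 0 < Real.cos v :=
  Real.cos_pos_of_mem_Ioo (abs_lt.mp (hv.trans_lt hh))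

theorem integral_one_div_sin_sq_add_sinh_sq {h y : ℝ} (h0 : 0 < h) (hh : h < π / 2)
    (hy : y ≠ 0) :
    ∫ v in (-h)..h, 1 / (Real.sin v ^ 2 + Real.sinh y ^ 2) =
      2 * Real.arctan (Real.cosh y / Real.sinh y * Real.tan h) /
        (Real.sinh y * Real.cosh y) := by
  have hs := Real.sinh_ne_zero.mpr hy
  have hch := (Real.cosh_pos y).ne'
  have hderiv : ∀ v ∈ Set.uIcc (-h) h, HasDerivAt
      (fun v => Real.arctan (Real.cosh y / Real.sinh y * Real.tan v) /
        (Real.sinh y * Real.cosh y)) (1 / (Real.sin v ^ 2 + Real.sinh y ^ 2)) v := by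
    intro v hv
    rw [Set.uIcc_of_le (by linarith)] at hv
    have hcos := (cos_pos_of_abs_le_s15 hh (abs_le.mpr hv)).ne'
    convert! (((Real.hasDerivAt_tan hcos).const_mul (Real.cosh y / Real.sinh y)).arctan).div_const
      (Real.sinh y * Real.cosh y) using 1
    have hD := (sin_sq_add_sinh_sq_pos v hy).ne'
    have e : 1 + (Real.cosh y / Real.sinh y * Real.tan v) ^ 2 =
        (Real.sin v ^ 2 + Real.sinh y ^ 2) / (Real.cos v ^ 2 * Real.sinh y ^ 2) := by
      rw [Real.tan_eq_sin_div_cos, eq_div_iff (by positivity)]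
      field_simp
      rw [Real.cosh_sq, Real.cos_sq']
      ring
    rw [e]
    field_simp
  rw [intervalIntegral.integral_eq_sub_of_hasDerivAt hderiv
    (Continuous.intervalIntegrable (continuous_const.div (by fun_prop) fun v =>
      (sin_sq_add_sinh_sq_pos v hy).ne') _ _), Real.tan_neg, mul_neg, Real.arctan_neg]
  ring

theorem two_mul_integral_add_sum_eq_sum_Icc {G : ℝ → ℝ} (heven : ∀ t, G (-t) = G t) {h p : ℝ}
    (hint : IntervalIntegrable G volume 0 h) (N : ℕ) :
    2 * ((∫ t in (0 : ℝ)..h, G t) +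
        ∑ k ∈ Finset.range N, ∫ t in (-h)..h, G (t + ((k + 1 : ℕ) : ℝ) * p)) =
      ∑ n ∈ Finset.Icc (-(N : ℤ)) N, ∫ t in (-h)..h, G (t + n * p) := by
  induction N with
  | zero =>
    have hleft : ∫ t in (-h)..0, G t = ∫ t in (0 : ℝ)..h, G t := by
      simpa [heven] using (intervalIntegral.integral_comp_neg (a := 0) (b := h) G).symm
    have hint' : IntervalIntegrable G volume (-h) 0 := by
      simpa [heven] using ((IntervalIntegrable.iff_comp_neg (by finiteness)).mp hint).symm
    simp only [Finset.range_zero, Finset.sum_empty, add_zero, Nat.cast_zero, neg_zero,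
      Finset.Icc_self, Finset.sum_singleton, Int.cast_zero, zero_mul]
    rw [← intervalIntegral.integral_add_adjacent_intervals hint' hint, hleft, two_mul]
  | succ N ih =>
    have hrefl : ∫ t in (-h)..h, G (t + ((-(N + 1) : ℤ) : ℝ) * p) =
        ∫ t in (-h)..h, G (t + ((N + 1 : ℤ) : ℝ) * p) := by
      have e := intervalIntegral.integral_comp_neg (a := -h) (b := h)
        (fun t => G (t + ((N + 1 : ℤ) : ℝ) * p))
      rw [neg_neg] at e
      rw [← e]
      refine intervalIntegral.integral_congr fun t _ => ?_
      rw [← heven]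
      congr 1
      push_cast
      ring
    rw [Finset.sum_range_succ, Nat.cast_succ (R := ℤ), Finset.sum_Icc_succ_eq_add_endpoints, ← ih,
      hrefl]
    push_cast
    ring

theorem tendsto_integral_add_sum_integral_shift {c : ℝ} (hc : c ∈ Set.Ioo (-1 : ℝ) 1) {h y : ℝ}
    (hy : 0 < y) (h0 : 0 < h) (hh : h < π / 2) :
    Tendsto (fun N : ℕ =>
        (∫ t in (0 : ℝ)..h, t * Real.sin (c * t) / (Real.cos t * (y ^ 2 + t ^ 2))) +
          ∑ k ∈ Finset.range N, ∫ t in (-h)..h,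
            (fun t => t * Real.sin (c * t) / (Real.cos t * (y ^ 2 + t ^ 2)))
              (t + ((k + 1 : ℕ) : ℝ) * π)) atTop
      (nhds (-(Real.sinh (c * y) / Real.cosh y) *
        Real.arctan (Real.cosh y / Real.sinh y * Real.tan h))) := by
  set G : ℝ → ℝ := fun t => t * Real.sin (c * t) / (Real.cos t * (y ^ 2 + t ^ 2)) with hG
  have hy2 (t : ℝ) : y ^ 2 + t ^ 2 ≠ 0 := by positivity
  have heven (t : ℝ) : G (-t) = G t := by simp [hG]
  have habs {v : ℝ} (hv : v ∈ Set.uIcc (-h) h) : |v| ≤ h := by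
    rw [Set.uIcc_of_le (by linarith)] at hv
    exact abs_le.mpr hv
  have hshift (v : ℝ) (n : ℤ) : G (v + n * π) = (1 / Real.cos v) *
      ((-1) ^ n * ((v + n * π) * Real.sin (c * (v + n * π)) / (y ^ 2 + (v + n * π) ^ 2))) := by
    have e : ((-1 : ℝ) ^ n)⁻¹ = (-1) ^ n := by
      rcases Int.even_or_odd n with hn | hn
      · simp [hn.neg_one_zpow]
      · simp [hn.neg_one_zpow]
    simp only [hG, Real.cos_add_int_mul_pi]
    rw [div_eq_mul_inv, mul_inv, mul_inv, e]
    ring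
  have hcont (n : ℤ) : ContinuousOn (fun v => G (v + n * π)) (Set.uIcc (-h) h) := by
    simp_rw [hshift]
    refine ContinuousOn.mul ?_ (Continuous.continuousOn ?_)
    · exact continuousOn_const.div Real.continuous_cos.continuousOn fun v hv =>
        (cos_pos_of_abs_le_s15 hh (habs hv)).ne'
    · exact continuous_const.mul (Continuous.div (by fun_prop) (by fun_prop) fun v => hy2 _)
  have hint0 : IntervalIntegrable G volume 0 h := by
    refine ContinuousOn.intervalIntegrable ?_
    have := hcont 0
    simp only [Int.cast_zero, zero_mul, add_zero] at this
    refine this.mono (Set.uIcc_subset_uIcc_right ?_)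
    rw [Set.uIcc_of_le (by linarith)]
    exact ⟨by linarith, h0.le⟩
  obtain ⟨K, hK⟩ := exists_abs_sum_neg_one_zpow_mul_sin_div_le hc hy.ne'
  have hlim : Tendsto (fun N : ℕ => ∫ v in (-h)..h,
      ∑ n ∈ Finset.Icc (-(N : ℤ)) N, G (v + n * π)) atTop
      (nhds (∫ v in (-h)..h, -(Real.sinh (c * y) * Real.sinh y) *
        (1 / (Real.sin v ^ 2 + Real.sinh y ^ 2)))) := by
    refine intervalIntegral.tendsto_integral_filter_of_dominated_convergence
      (fun _ => 1 / Real.cos h * K) (Eventually.of_forall fun N => ?_)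
      (Eventually.of_forall fun N => ae_of_all _ fun v hv => ?_)
      intervalIntegrable_const (ae_of_all _ fun v hv => ?_)
    · exact ((continuousOn_finsetSum _ fun n _ => hcont n).mono
        Set.uIoc_subset_uIcc).aestronglyMeasurable measurableSet_uIoc
    · have hv' := habs (Set.uIoc_subset_uIcc hv)
      have hcosh : 0 < Real.cos h := cos_pos_of_abs_le_s15 hh (abs_of_pos h0).le
      have hcos : Real.cos h ≤ Real.cos v := by
        rw [← Real.cos_abs v]
        exact Real.cos_le_cos_of_nonneg_of_le_pi (abs_nonneg v) (by linarith [pi_pos]) hv'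
      simp_rw [hshift, ← Finset.mul_sum]
      rw [norm_mul, Real.norm_of_nonneg (one_div_pos.mpr (hcosh.trans_le hcos)).le,
        Real.norm_eq_abs]
      exact mul_le_mul (one_div_le_one_div_of_le hcosh hcos) (hK v (hv'.trans hh.le) N)
        (abs_nonneg _) (by positivity)
    · have hv' := habs (Set.uIoc_subset_uIcc hv)
      have hcos := (cos_pos_of_abs_le_s15 hh hv').ne'
      simp_rw [hshift, ← Finset.mul_sum]
      convert! (tendsto_sum_neg_one_zpow_mul_sin_div hc (hv'.trans hh.le) hy.ne').const_mul
        (1 / Real.cos v) using 2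
      field_simp
  rw [intervalIntegral.integral_const_mul,
    integral_one_div_sin_sq_add_sinh_sq h0 hh hy.ne'] at hlim
  have hs := (Real.sinh_pos_iff.mpr hy).ne'
  convert! hlim.const_mul (1 / 2) using 1
  · ext N
    rw [intervalIntegral.integral_finsetSum fun n _ => (hcont n).intervalIntegrable,
      ← two_mul_integral_add_sum_eq_sum_Icc heven hint0]
    ring
  · congr 1
    field_simp

theorem tendsto_arctan_mul_tan_pi_div_two_sub {b κ : ℝ} (hb : 0 < b) (hκ : 0 < κ) :
    Tendsto (fun ε => Real.arctan (κ * Real.tan (π / 2 - b * ε)))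
      (nhdsWithin 0 (Set.Ioi 0)) (nhds (π / 2)) := by
  have h : Tendsto (fun ε : ℝ => π / 2 - b * ε) (nhdsWithin 0 (Set.Ioi 0))
      (nhdsWithin (π / 2) (Set.Iio (π / 2))) := by
    refine tendsto_nhdsWithin_iff.mpr ⟨?_, ?_⟩
    · have : Continuous fun ε : ℝ => π / 2 - b * ε := by fun_prop
      simpa using (this.tendsto 0).mono_left nhdsWithin_le_nhds
    · filter_upwards [self_mem_nhdsWithin] with ε hε
      have := mul_pos hb hε
      simpa using this
  exact (tendsto_nhds_of_tendsto_nhdsWithin Real.tendsto_arctan_atTop).comp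
    ((Real.tendsto_tan_pi_div_two.comp h).const_mul_atTop hκ)

theorem pv_t_sin_over_cos (a b x : ℝ) (hx : 0 < x) (ha : 0 < a) (hab : a < b) :
    IsPVIntegral (fun t => t * Real.sin (a * t) / (Real.cos (b * t) * (x ^ 2 + t ^ 2))) (fun k => (2 * (k : ℝ) + 1) * Real.pi / (2 * b)) (-(Real.pi / 2) * Real.sinh (a * x) / Real.cosh (b * x)) := by
  have hb : 0 < b := ha.trans hab
  have hy : 0 < b * x := mul_pos hb hx
  have hc : a / b ∈ Set.Ioo (-1 : ℝ) 1 :=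
    ⟨by linarith [div_pos ha hb], (div_lt_one hb).mpr hab⟩
  have hcy : a / b * (b * x) = a * x := by field_simp
  set G : ℝ → ℝ := fun t =>
    t * Real.sin (a / b * t) / (Real.cos t * ((b * x) ^ 2 + t ^ 2)) with hG
  have hf (t : ℝ) : t * Real.sin (a * t) / (Real.cos (b * t) * (x ^ 2 + t ^ 2)) =
      b * G (b * t) := by
    have e1 : a / b * (b * t) = a * t := by field_simp
    have e2 : (b * x) ^ 2 + (b * t) ^ 2 = b ^ 2 * (x ^ 2 + t ^ 2) := by ring
    simp only [hG, e1, e2]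
    field_simp
  have hint (s t : ℝ) :
      ∫ t in s..t, t * Real.sin (a * t) / (Real.cos (b * t) * (x ^ 2 + t ^ 2)) =
        ∫ t in (b * s)..(b * t), G t := by
    simp_rw [hf]
    rw [intervalIntegral.integral_const_mul, intervalIntegral.mul_integral_comp_mul_left]
  refine ⟨π / (2 * b), by positivity, fun ε => -(Real.sinh (a * x) / Real.cosh (b * x)) *
    Real.arctan (Real.cosh (b * x) / Real.sinh (b * x) * Real.tan (π / 2 - b * ε)), ?_, ?_⟩
  · intro ε hε
    have hbε : b * ε < π / 2 := by
      have := (lt_div_iff₀ (by positivity)).mp hε.2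
      linarith
    have h0 : 0 < π / 2 - b * ε := by linarith
    have h1 : π / 2 - b * ε < π / 2 := by linarith [mul_pos hb hε.1]
    have h := tendsto_integral_add_sum_integral_shift hc hy h0 h1
    rw [hcy] at h
    refine h.congr fun N => ?_
    simp_rw [hint]
    congr 1
    · congr 1
      · simp
      · simp
        field_simp
    · refine Finset.sum_congr rfl fun k _ => ?_
      change ∫ v in _.._, G (v + ((k + 1 : ℕ) : ℝ) * π) = _
      rw [intervalIntegral.integral_comp_add_right]
      congr 1 <;> (push_cast; field_simp; ring)
  · have h := (tendsto_arctan_mul_tan_pi_div_two_sub hb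
      (div_pos (Real.cosh_pos (b * x)) (Real.sinh_pos_iff.mpr hy))).const_mul
      (-(Real.sinh (a * x) / Real.cosh (b * x)))
    convert! h using 2
    ring
end
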